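/- Let n > 2, σ ∈ (0, n−2), β ∈ (0,∞), ξ(x) = |x|^{−σ}, and let V: (0,∞) → [0,∞) be twice differentiable and increasing with sV'(s) ≥ B V(s) for all large s (some B > 0). Assume in addition that s^{−2(1+σ)}( ¼V'(s)² − ½V''(s) ) → ∞ as s → ∞. Then for every a > 0, setting U(x,z) = V(βN(x,z) + ξ(x)) (for x ≠ 0) and assuming 0 < Z := ∫ e^{−U} dλ < ∞, the probability measure dμ_U = Z⁻¹ e^{−U} dλ satisfies the Poincaré inequality: there exists c ∈ (0,∞) with μ_U((f − μ_U(f))²) ≤ c μ_U(|∇f|²) for every smooth compactly supported f. -/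

import Mathlib

open Real MeasureTheory Filter

/-- A point of the type-2 Carnot group `ℝ^{n+m}`. -/
abbrev Pt (n m : ℕ) := (Fin n → ℝ) × (Fin m → ℝ)

/-- The horizontal vector field
`X_i = ∂/∂x_i + (1/2) Σ_k Σ_l Λ^{(k)}_{il} x_l ∂/∂z_k` on the type-2 Carnot group. -/
noncomputable def X {n m : ℕ} (Λ : Fin m → Fin n → Fin n → ℝ) (i : Fin n)
    (f : Pt n m → ℝ) (p : Pt n m) : ℝ :=
  fderiv ℝ f p (Pi.single i 1, 0) +
    (1 / 2) * ∑ k : Fin m, ∑ l : Fin n,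
      Λ k i l * p.1 l * fderiv ℝ f p (0, Pi.single k 1)

/-- The squared length of the sub-gradient, `|∇f|² = Σ_i (X_i f)²`. -/
noncomputable def gradSq {n m : ℕ} (Λ : Fin m → Fin n → Fin n → ℝ)
    (f : Pt n m → ℝ) (p : Pt n m) : ℝ :=
  ∑ i : Fin n, (X Λ i f p) ^ 2

/-- The sub-Laplacian `Δf = Σ_i X_i² f`. -/
noncomputable def subLap {n m : ℕ} (Λ : Fin m → Fin n → Fin n → ℝ)
    (f : Pt n m → ℝ) (p : Pt n m) : ℝ :=
  ∑ i : Fin n, X Λ i (X Λ i f) p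

/-- The smooth homogeneous norm `N(x,z) = (|x|⁴ + a|z|²)^(1/4)`. -/
noncomputable def Nrm {n m : ℕ} (a : ℝ) (p : Pt n m) : ℝ :=
  ((∑ i, p.1 i ^ 2) ^ 2 + a * ∑ j, p.2 j ^ 2) ^ ((1 : ℝ) / 4)

/-- Euclidean length of the horizontal component `x` of a point. -/
noncomputable def xnorm {n m : ℕ} (p : Pt n m) : ℝ :=
  Real.sqrt (∑ i, p.1 i ^ 2)

/-- The normalized Gibbs measure `Z⁻¹ e^{−U} dλ`. -/
noncomputable def gibbsP {E : Type*} [MeasureSpace E] (U : E → ℝ) : Measure E :=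
  (ENNReal.ofReal (∫ p, Real.exp (-(U p))))⁻¹ •
    (volume.withDensity fun p => ENNReal.ofReal (Real.exp (-(U p))))

/-- The additively tamed energy `U(x,z) = V(β N(x,z) + |x|^(−σ))` on a type-2 Carnot group. -/
noncomputable def Uadd {n m : ℕ} (a β σ : ℝ) (V : ℝ → ℝ) (p : Pt n m) : ℝ :=
  V (β * Nrm a p + xnorm p ^ (-σ))

theorem V'_growth {σ : ℝ} (hσ : 0 < σ) {V V' V'' : ℝ → ℝ}
    (hVmono : StrictMonoOn V (Set.Ioi (0 : ℝ)))
    (hV' : ∀ s > (0 : ℝ), HasDerivAt V (V' s) s)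
    (hV'' : ∀ s > (0 : ℝ), HasDerivAt V' (V'' s) s)
    (hV2 : Tendsto (fun s => s ^ (-(2 * (1 + σ))) * ((1 / 4) * (V' s) ^ 2 - (1 / 2) * V'' s))
      atTop atTop) :
    (∀ s > 0, 0 ≤ V' s) ∧ ∀ M : ℝ, 0 < M → ∃ R : ℝ, 1 ≤ R ∧ ∀ s ≥ R, M * s ≤ V' s := by
  have hpos : ∀ s > 0, 0 ≤ V' s := by
    intro s hs
    by_contra! hneg
    have h1 := (hV' s hs).tendsto_slope
    have h2 : ∀ᶠ u in nhdsWithin s {s}ᶜ, slope V s u < 0 := h1.eventually (gt_mem_nhds hneg)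
    have h3 : ∀ᶠ u in nhdsWithin s (Set.Ioi s), slope V s u < 0 :=
      h2.filter_mono (nhdsWithin_mono _ (fun u hu => ne_of_gt hu))
    obtain ⟨u, hu, hus⟩ := (h3.and self_mem_nhdsWithin).exists
    have hus' : s < u := hus
    have := hVmono (Set.mem_Ioi.2 hs) (Set.mem_Ioi.2 (hs.trans hus')) hus'
    rw [slope_def_field] at hu
    have : 0 < (V u - V s) / (u - s) := div_pos (by linarith) (by linarith)
    linarith
  refine ⟨hpos, fun M hM => ?_⟩
  obtain ⟨R, hR⟩ := (hV2.eventually_ge_atTop (M ^ 2)).exists_forall_of_atTop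
  refine ⟨max R 1, le_max_right _ _, fun s0 hs0 => ?_⟩
  have hs1 : 1 ≤ s0 := (le_max_right _ _).trans hs0
  have hsR : R ≤ s0 := (le_max_left _ _).trans hs0
  by_contra! hlt
  have hkey : ∀ s ≥ s0, M ^ 2 * s0 ^ 2 ≤ (1 / 4) * (V' s) ^ 2 - (1 / 2) * V'' s := by
    intro s hs
    have hsp : 0 < s := by linarith
    have h1 := hR s (hsR.trans hs)
    have h2 : s ^ 2 ≤ s ^ (2 * (1 + σ)) := by
      rw [← Real.rpow_natCast]
      exact Real.rpow_le_rpow_of_exponent_le (by linarith) (by push_cast; linarith)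
    rw [Real.rpow_neg hsp.le, inv_mul_eq_div, le_div_iff₀ (Real.rpow_pos_of_pos hsp _)] at h1
    have h3 : s0 ^ 2 ≤ s ^ 2 := by gcongr
    have : M ^ 2 * s0 ^ 2 ≤ M ^ 2 * s ^ (2 * (1 + σ)) := by gcongr; linarith
    linarith
  have hMs : 0 < M * s0 := by positivity
  have hbd : ∀ b, ∀ s ∈ Set.Icc s0 b, V' s ≤ M * s0 := by
    intro b
    refine image_le_of_deriv_right_lt_deriv_boundary' (f' := V'') (B := fun _ => M * s0) (B' := fun _ => 0) ?_ ?_ hlt.le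
      continuousOn_const ?_ ?_
    · intro s hs
      exact (hV'' s (by linarith [hs.1])).continuousAt.continuousWithinAt
    · intro s hs
      exact (hV'' s (by linarith [hs.1])).hasDerivWithinAt
    · intro s hs
      exact hasDerivWithinAt_const _ _ _
    · intro s hs he
      have := hkey s hs.1
      rw [he] at this
      nlinarith [mul_pos hMs hMs]
  have hder : ∀ s ≥ s0, V'' s ≤ - (M * s0) ^ 2 := by
    intro s hs
    have h1 := hkey s hs
    have h2 := hbd s s ⟨hs, le_rfl⟩
    have h3 := hpos s (by linarith)
    nlinarith [mul_self_le_mul_self h3 h2]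
  set b := s0 + 1 / (M * s0) with hb
  have hbs : s0 < b := by rw [hb]; linarith [one_div_pos.2 hMs]
  obtain ⟨c, hc, hce⟩ := exists_hasDerivAt_eq_slope V' V'' hbs
    (fun s hs => (hV'' s (by linarith [hs.1])).continuousAt.continuousWithinAt)
    (fun s hs => hV'' s (by linarith [hs.1]))
  have h1 := hder c hc.1.le
  rw [hce, div_le_iff₀ (by linarith)] at h1
  have h2 := hpos b (by linarith)
  have h3 : b - s0 = 1 / (M * s0) := by rw [hb]; ring
  rw [h3] at h1
  have h4 : -(M * s0) ^ 2 * (1 / (M * s0)) = -(M * s0) := by field_simp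
  linarith

/-- Divergence value of the vector field as an expression in scalar invariants. -/
noncomputable def divE (n σ β a L t N Y U G F η : ℝ) : ℝ :=
  2 * β * t / N ^ 3 - 3 * β * t ^ 3 / N ^ 7 + σ * (σ + 2) * η + n * (β * t / N ^ 3 - σ * η)
    - L * a * Y / (2 * N ^ 6) + L * U / (2 * N ^ 2) + L * a * t * Y / (2 * N ^ 8)
    + L * (a / 8) / N ^ 4 * (G / 2 - F)

theorem divE_le {n σ β a L t N ζ Y U G F η K c0 : ℝ} (hβ : 0 < β) (ha : 0 < a) (hL : 0 < L)
    (ht : 0 < t) (hN : 0 < N) (hζ : 0 ≤ ζ) (hP : N ^ 4 = t ^ 2 + a * ζ) (hK : 0 ≤ K)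
    (hY : 0 ≤ Y) (hYK : Y ≤ K * ζ * t) (hU : U ≤ K * t) (hG : G ≤ (N ^ 2 * U + K * Y / N ^ 2) / 2)
    (hc0 : 0 < c0) (hF : c0 * ζ ≤ F) :
    divE n σ β a L t N Y U G F η ≤ (n + 2) * β * t / N ^ 3 - σ * (n - 2 - σ) * η
      + L * ((K + a * K / 32 + K ^ 2 / 32 + c0 / 8) * (t / N ^ 2) - c0 / 8) := by
  have hτ : t / N ^ 2 ≤ 1 := by
    rw [div_le_one (by positivity)]
    have : t ^ 2 ≤ (N ^ 2) ^ 2 := by nlinarith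
    exact le_of_sq_le_sq this (by positivity)
  have hτ0 : 0 ≤ t / N ^ 2 := by positivity
  have hζN : ζ = N ^ 4 * (1 - (t / N ^ 2) ^ 2) / a := by
    field_simp; linarith
  have hζN' : a * ζ / N ^ 4 = 1 - (t / N ^ 2) ^ 2 := by
    rw [hζN]; field_simp
  have hζN1 : a * ζ / N ^ 4 ≤ 1 := by rw [hζN']; nlinarith
  -- individual bounds
  have hYN : a * Y / N ^ 6 ≤ K * (t / N ^ 2) := by
    calc a * Y / N ^ 6 ≤ a * (K * ζ * t) / N ^ 6 := by gcongr
      _ = K * (t / N ^ 2) * (a * ζ / N ^ 4) := by field_simp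
      _ ≤ K * (t / N ^ 2) * 1 := by gcongr
      _ = _ := by ring
  have hY0 : 0 ≤ a * Y / N ^ 6 := by positivity
  have hUN : U / N ^ 2 ≤ K * (t / N ^ 2) := by
    rw [← mul_div_assoc]; gcongr
  have e1 : L * a * t * Y / (2 * N ^ 8) = L / 2 * ((a * Y / N ^ 6) * (t / N ^ 2)) := by field_simp
  have b1 : (a * Y / N ^ 6) * (t / N ^ 2) ≤ K * (t / N ^ 2) := by
    calc (a * Y / N ^ 6) * (t / N ^ 2) ≤ (a * Y / N ^ 6) * 1 := by gcongr
      _ ≤ _ := by linarith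
  have e2 : L * U / (2 * N ^ 2) = L / 2 * (U / N ^ 2) := by field_simp
  have e3 : L * a * Y / (2 * N ^ 6) = L / 2 * (a * Y / N ^ 6) := by field_simp
  have b4 : L * (a / 8) / N ^ 4 * (G / 2 - F) ≤
      L * (a / 8) / N ^ 4 * ((N ^ 2 * U + K * Y / N ^ 2) / 4 - c0 * ζ) := by
    apply mul_le_mul_of_nonneg_left _ (by positivity)
    linarith
  have e4 : L * (a / 8) / N ^ 4 * ((N ^ 2 * U + K * Y / N ^ 2) / 4 - c0 * ζ) =
      L * (a / 32 * (U / N ^ 2) + K / 32 * (a * Y / N ^ 6) - c0 / 8 * (a * ζ / N ^ 4)) := by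
    field_simp; ring
  have b5 : a / 32 * (U / N ^ 2) ≤ a / 32 * (K * (t / N ^ 2)) := by gcongr
  have b6 : K / 32 * (a * Y / N ^ 6) ≤ K / 32 * (K * (t / N ^ 2)) := by gcongr
  have b7 : 1 - (t / N ^ 2) ≤ a * ζ / N ^ 4 := by rw [hζN']; nlinarith
  have b8 : c0 / 8 * (1 - (t / N ^ 2)) ≤ c0 / 8 * (a * ζ / N ^ 4) := by gcongr
  have b9 : 0 ≤ 3 * β * t ^ 3 / N ^ 7 := by positivity
  have c1 : L / 2 * ((a * Y / N ^ 6) * (t / N ^ 2)) ≤ L / 2 * (K * (t / N ^ 2)) := by gcongr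
  have c2 : L / 2 * (U / N ^ 2) ≤ L / 2 * (K * (t / N ^ 2)) := by gcongr
  have c3 : 0 ≤ L / 2 * (a * Y / N ^ 6) := by positivity
  have c4 : L * (a / 32 * (U / N ^ 2) + K / 32 * (a * Y / N ^ 6) - c0 / 8 * (a * ζ / N ^ 4)) ≤
    L * (a / 32 * (K * (t / N ^ 2)) + K / 32 * (K * (t / N ^ 2)) - c0 / 8 * (1 - (t / N ^ 2))) := by
    gcongr
  unfold divE
  rw [e1, e2, e3]
  rw [e4] at b4
  have e5 : (n + 2) * β * t / N ^ 3 = 2 * β * t / N ^ 3 + n * (β * t / N ^ 3) := by ring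
  rw [e5]
  linarith

theorem rad_bound {σ κ B : ℝ} (hσ : 0 < σ) (hκ : 0 < κ) :
    ∃ C : ℝ, 0 < C ∧ ∀ t > (0 : ℝ), B * t ^ (-(1 : ℝ) / 2) ≤ κ * t ^ (-σ / 2 - 1) + C := by
  refine ⟨κ + B ^ 2 / κ + 1, by positivity, fun t ht => ?_⟩
  have h1 : (t ^ (-(1 : ℝ) / 2)) ^ 2 ≤ t ^ (-σ / 2 - 1) + 1 := by
    rw [← Real.rpow_natCast, ← Real.rpow_mul ht.le]
    rcases le_total t 1 with h | h
    · have : t ^ (-(1 : ℝ) / 2 * (2 : ℕ)) ≤ t ^ (-σ / 2 - 1) :=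
        Real.rpow_le_rpow_of_exponent_ge ht h (by push_cast; linarith)
      linarith
    · have : t ^ (-(1 : ℝ) / 2 * (2 : ℕ)) ≤ 1 :=
        Real.rpow_le_one_of_one_le_of_nonpos h (by push_cast; linarith)
      have := Real.rpow_pos_of_pos ht (-σ / 2 - 1)
      linarith
  set r := t ^ (-(1 : ℝ) / 2)
  have h2 : B * r ≤ κ * r ^ 2 + B ^ 2 / κ := by
    rw [← sub_nonneg]
    have : κ * r ^ 2 + B ^ 2 / κ - B * r = ((κ * r - B / 2) ^ 2 + 3 / 4 * B ^ 2) / κ := by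
      field_simp; ring
    rw [this]; positivity
  have h3 : κ * r ^ 2 ≤ κ * (t ^ (-σ / 2 - 1) + 1) := by gcongr
  linarith

/-- The scalar `W · ∇s`. -/
noncomputable def wsE (σ β a L t N Y η : ℝ) : ℝ :=
  (β * t / N ^ 3 - σ * η) ^ 2 * t - L * (a / 8) / N ^ 4 * (β * t / N ^ 3 - σ * η) * Y
    + L / N ^ 2 * (β * a / (4 * N ^ 3)) * Y

theorem tau_le_one {a t N ζ : ℝ} (ha : 0 < a) (hN : 0 < N) (hζ : 0 ≤ ζ)
    (hP : N ^ 4 = t ^ 2 + a * ζ) : t / N ^ 2 ≤ 1 := by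
  rw [div_le_one (by positivity)]
  have : t ^ 2 ≤ (N ^ 2) ^ 2 := by nlinarith
  exact le_of_sq_le_sq this (by positivity)

theorem wsE_ge {σ β a L t N ζ Y η : ℝ} (hσ : 0 < σ) (hβ : 0 < β) (ha : 0 < a) (hL : 0 < L)
    (hN : 0 < N) (hζ : 0 ≤ ζ) (hP : N ^ 4 = t ^ 2 + a * ζ)
    (hY : 0 ≤ Y) (hη : 0 < η) :
    (β * t / N ^ 3 - σ * η) ^ 2 * t + L * β * (a / 8) * Y / N ^ 5 ≤ wsE σ β a L t N Y η := by
  have hτ := tau_le_one ha hN hζ hP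
  have h1 : L * (a / 8) / N ^ 4 * (β * t / N ^ 3 - σ * η) * Y ≤ L * β * (a / 8) * Y / N ^ 5 := by
    have h2 : L * β * (a / 8) * Y / N ^ 5 = L * (a / 8) / N ^ 4 * (β / N) * Y := by field_simp
    have h3 : β * t / N ^ 3 - σ * η ≤ β / N := by
      have : β * t / N ^ 3 = β / N * (t / N ^ 2) := by field_simp
      rw [this]
      have : β / N * (t / N ^ 2) ≤ β / N * 1 := by gcongr
      have : 0 < σ * η := by positivity
      linarith
    rw [h2]; gcongr
  have h4 : L / N ^ 2 * (β * a / (4 * N ^ 3)) * Y = 2 * (L * β * (a / 8) * Y / N ^ 5) := by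
    field_simp; ring
  unfold wsE
  rw [h4]; linarith

theorem ww_le {σ β a L t N ζ Y η QQ K ww : ℝ} (ha : 0 < a)
    (hN : 0 < N) (hP : N ^ 4 = t ^ 2 + a * ζ) (hK : 0 ≤ K)
    (hY : 0 ≤ Y) (hQ : QQ ≤ K * ζ * Y)
    (hww : ww ≤ 3 * ((β * t / N ^ 3 - σ * η) ^ 2 * t + L ^ 2 / N ^ 4 * Y +
      (L * (a / 8) / N ^ 4) ^ 2 * QQ)) :
    ww ≤ 3 * (β * t / N ^ 3 - σ * η) ^ 2 * t + 3 * (1 + a * K / 64) * L ^ 2 * Y / N ^ 4 := by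
  have hz : a * ζ ≤ N ^ 4 := by nlinarith [sq_nonneg t]
  have h1 : (L * (a / 8) / N ^ 4) ^ 2 * QQ ≤ (L * (a / 8) / N ^ 4) ^ 2 * (K * ζ * Y) := by gcongr
  have h2 : (L * (a / 8) / N ^ 4) ^ 2 * (K * ζ * Y) = (L ^ 2 * (a / 64) * K * Y / N ^ 8) * (a * ζ) := by
    field_simp; ring
  have h3 : (L ^ 2 * (a / 64) * K * Y / N ^ 8) * (a * ζ) ≤ (L ^ 2 * (a / 64) * K * Y / N ^ 8) * N ^ 4 := by
    gcongr
  have h4 : (L ^ 2 * (a / 64) * K * Y / N ^ 8) * N ^ 4 = L ^ 2 * (a / 64) * K * Y / N ^ 4 := by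
    field_simp
  have h5 : 3 * (1 + a * K / 64) * L ^ 2 * Y / N ^ 4 = 3 * (L ^ 2 / N ^ 4 * Y) +
     3 * (L ^ 2 * (a / 64) * K * Y / N ^ 4) := by ring
  rw [h5]; linarith

/-- Hypotheses on the scalar invariants at a point. -/
structure Scal (a K c0 t N ζ Y U G F : ℝ) : Prop where
  ht : 0 < t
  hN : 0 < N
  hζ : 0 ≤ ζ
  hP : N ^ 4 = t ^ 2 + a * ζ
  hY : 0 ≤ Y
  hYK : Y ≤ K * ζ * t
  hU : U ≤ K * t
  hG : G ≤ (N ^ 2 * U + K * Y / N ^ 2) / 2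
  hF : c0 * ζ ≤ F

set_option maxHeartbeats 1000000 in
theorem key_real {n σ β a K c0 : ℝ} (hσ : 0 < σ) (hσn : σ < n - 2) (hβ : 0 < β) (ha : 0 < a)
    (hK : 0 ≤ K) (hc0 : 0 < c0) :
    ∃ L > 0, ∃ M > 0, ∃ R0 ≥ (1 : ℝ), ∃ CD ≥ (0 : ℝ), ∀ t N ζ Y U G F : ℝ,
      Scal a K c0 t N ζ Y U G F →
      divE n σ β a L t N Y U G F (t ^ (-σ / 2 - 1)) ≤ CD ∧
      ∀ QQ ww v : ℝ, QQ ≤ K * ζ * Y →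
        ww ≤ 3 * ((β * t / N ^ 3 - σ * t ^ (-σ / 2 - 1)) ^ 2 * t + L ^ 2 / N ^ 4 * Y +
          (L * (a / 8) / N ^ 4) ^ 2 * QQ) →
        R0 ≤ β * N + t ^ (-σ / 2) → M * (β * N + t ^ (-σ / 2)) ≤ v →
        1 ≤ v * wsE σ β a L t N Y (t ^ (-σ / 2 - 1))
          - divE n σ β a L t N Y U G F (t ^ (-σ / 2 - 1)) - ww := by
  have hκ : 0 < σ * (n - 2 - σ) / 2 := by
    have : 0 < n - 2 - σ := by linarith
    positivity
  set κ := σ * (n - 2 - σ) / 2 with hκd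
  obtain ⟨C3, hC3, hrad⟩ := rad_bound (B := (n + 2) * β) hσ hκ
  set c1 := c0 / 8 with hc1
  have hc1p : 0 < c1 := by positivity
  set C2 := K + a * K / 32 + K ^ 2 / 32 + c0 / 8 with hC2
  have hC2p : 0 < C2 := by positivity
  set L := 2 * (C3 + 1) / c1 with hLd
  have hL : 0 < L := by positivity
  set τ0 := c1 / (2 * C2) with hτ0
  have hτ0p : 0 < τ0 := by positivity
  set C4 := C3 + L * C2 + 1 with hC4
  have hC4p : 0 < C4 := by positivity
  set ω := Real.sqrt τ0 with hω
  have hωp : 0 < ω := Real.sqrt_pos.2 hτ0p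
  have hωsq : ω ^ 2 = τ0 := Real.sq_sqrt hτ0p.le
  set e := β * ω ^ 3 / 2 with he
  have hep : 0 < e := by positivity
  have hlim : ∃ t1 > (0 : ℝ), ∀ t ≥ t1, t ^ (-((σ + 1) / 2)) ≤ e / σ := by
    have h1 := tendsto_rpow_neg_atTop (y := (σ + 1) / 2) (by linarith)
    obtain ⟨t1, h2⟩ := (h1.eventually (gt_mem_nhds (show 0 < e / σ by positivity))).exists_forall_of_atTop
    exact ⟨max t1 1, by positivity, fun t ht => (h2 t ((le_max_left _ _).trans ht)).le⟩
  obtain ⟨t1, ht1, hlim⟩ := hlim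
  clear_value e ω C4 τ0 L C2 c1 κ
  refine ⟨L, hL, 6 + 8 * (3 * (1 + a * K / 64)) * L / (a * β ^ 2) + 2 * C4 / e ^ 2, by positivity,
    β * Real.sqrt (t1 / τ0) + 2 + C4 / κ, ?_, C3 + L * C2, by positivity, ?_⟩
  · have : 0 ≤ β * Real.sqrt (t1 / τ0) := by positivity
    have : 0 < C4 / κ := by positivity
    linarith
  intro t N ζ Y U G F hS
  obtain ⟨ht, hN, hζ, hP, hY, hYK, hU, hG, hF⟩ := hS
  have hη : 0 < t ^ (-σ / 2 - 1) := Real.rpow_pos_of_pos ht _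
  set η := t ^ (-σ / 2 - 1) with hηd
  have hτ := tau_le_one ha hN hζ hP
  have hτnn : 0 ≤ t / N ^ 2 := by positivity
  set τ := t / N ^ 2 with hτd
  clear_value τ η
  have hr : 0 < Real.sqrt t := Real.sqrt_pos.2 ht
  have hrsq : Real.sqrt t ^ 2 = t := Real.sq_sqrt ht.le
  have hrN : Real.sqrt t ≤ N := by
    apply le_of_sq_le_sq _ hN.le
    rw [hrsq]
    rwa [hτd, div_le_one (by positivity)] at hτ
  have hdiv1 := divE_le (n := n) (σ := σ) (η := η) hβ ha hL ht hN hζ hP hK hY hYK hU hG hc0 hF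
  have hn2 : 0 < (n + 2) * β := by
    apply mul_pos _ hβ; linarith
  have hr2 : (n + 2) * β * t / N ^ 3 ≤ κ * η + C3 := by
    rw [hηd]
    refine le_trans ?_ (hrad t ht)
    have h1 : t ^ (-(1 : ℝ) / 2) = 1 / Real.sqrt t := by
      rw [neg_div, Real.rpow_neg ht.le, Real.sqrt_eq_rpow, one_div (t ^ _)]
    rw [h1, mul_div_assoc]
    apply mul_le_mul_of_nonneg_left _ hn2.le
    rw [div_le_div_iff₀ (by positivity) hr]
    calc t * Real.sqrt t = Real.sqrt t ^ 3 := by nth_rw 1 [← hrsq]; ring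
      _ ≤ N ^ 3 := by gcongr
      _ = 1 * N ^ 3 := by ring
  have hdiv : divE n σ β a L t N Y U G F η ≤ -κ * η + C3 + L * (C2 * τ - c1) := by
    have : σ * (n - 2 - σ) * η = 2 * κ * η := by rw [hκd]; ring
    rw [this, ← hC2, ← hτd, ← hc1] at hdiv1
    linarith
  have hLC : L * (C2 * τ - c1) ≤ L * C2 := by
    apply mul_le_mul_of_nonneg_left _ hL.le
    have : C2 * τ ≤ C2 * 1 := by gcongr
    linarith
  have hκη : 0 < κ * η := by positivity
  refine ⟨by linarith, ?_⟩
  intro QQ ww v hQ hww hs hv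
  have hws := wsE_ge (η := η) hσ hβ ha hL hN hζ hP hY hη
  have hww' := ww_le ha hN hP hK hY hQ hww
  have htσ : 0 < t ^ (-σ / 2) := Real.rpow_pos_of_pos ht _
  set s := β * N + t ^ (-σ / 2) with hsd
  have hsN : β * N ≤ s := by linarith
  have hs1 : 1 ≤ s := by
    have : 0 ≤ β * Real.sqrt (t1 / τ0) := by positivity
    have : 0 < C4 / κ := by positivity
    linarith
  have hT1 : 0 ≤ 8 * (3 * (1 + a * K / 64)) * L / (a * β ^ 2) := by positivity
  have hT2 : 0 ≤ 2 * C4 / e ^ 2 := by positivity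
  clear_value s
  generalize hA1 : 8 * (3 * (1 + a * K / 64)) * L / (a * β ^ 2) = A1 at *
  generalize hA2 : 2 * C4 / e ^ 2 = A2 at *
  have hMs : (6 + A1 + A2) * s = 6 * s + A1 * s + A2 * s := by ring
  have hA1s : 0 ≤ A1 * s := by positivity
  have hA2s : 0 ≤ A2 * s := by positivity
  have hA2s' : A2 ≤ A2 * s := le_mul_of_one_le_right hT2 hs1
  have hv6 : 6 ≤ v := by linarith
  have hvC : A2 ≤ v := by linarith
  have hvN : A1 * (β * N) ≤ v := by
    have : A1 * (β * N) ≤ A1 * s := by gcongr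
    linarith
  have hv0 : 0 ≤ v := by linarith
  have hα : 0 ≤ (β * t / N ^ 3 - σ * η) ^ 2 * t := by positivity
  set αt := (β * t / N ^ 3 - σ * η) ^ 2 * t with hαt
  clear_value αt
  have habs : 3 * (1 + a * K / 64) * L ^ 2 * Y / N ^ 4 ≤ v * (L * β * (a / 8) * Y / N ^ 5) := by
    calc 3 * (1 + a * K / 64) * L ^ 2 * Y / N ^ 4
        = (A1 * (β * N)) * (L * β * (a / 8) * Y / N ^ 5) := by
          rw [← hA1]; field_simp
      _ ≤ _ := by gcongr
  have hmain : 1 / 2 * v * αt - divE n σ β a L t N Y U G F η ≤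
      v * wsE σ β a L t N Y η - divE n σ β a L t N Y U G F η - ww := by
    have h1 : v * (αt + L * β * (a / 8) * Y / N ^ 5) ≤ v * wsE σ β a L t N Y η := by gcongr
    have h2 : 3 * αt ≤ 1 / 2 * v * αt := mul_le_mul_of_nonneg_right (by linarith) hα
    have h3 : 3 * (β * t / N ^ 3 - σ * η) ^ 2 * t = 3 * αt := by rw [hαt]; ring
    rw [h3] at hww'
    linarith
  refine le_trans ?_ hmain
  have hvα : 0 ≤ 1 / 2 * v * αt := by positivity
  by_cases hc : τ ≤ τ0
  · have h1 : C2 * τ ≤ c1 / 2 := by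
      calc C2 * τ ≤ C2 * τ0 := by gcongr
        _ = c1 / 2 := by rw [hτ0]; field_simp
    have h2 : L * (C2 * τ - c1) ≤ L * (-(c1 / 2)) := by
      apply mul_le_mul_of_nonneg_left _ hL.le; linarith
    have h3 : L * (-(c1 / 2)) = -(C3 + 1) := by rw [hLd]; field_simp
    linarith
  · push Not at hc
    by_cases hc2 : C4 ≤ κ * η
    · linarith
    · push Not at hc2
      have htt : t1 ≤ t := by
        by_contra! hlt
        have hNb : N ≤ Real.sqrt (t1 / τ0) := by
          apply Real.le_sqrt_of_sq_le
          rw [le_div_iff₀ hτ0p]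
          have : t = τ * N ^ 2 := by rw [hτd]; field_simp
          have h5 : N ^ 2 * τ0 ≤ N ^ 2 * τ := by gcongr
          linarith
        have h2 : t ^ (-σ / 2) ≤ 1 + C4 / κ := by
          rcases le_total t 1 with h | h
          · have h3 : t ^ (-σ / 2) ≤ η := by
              rw [hηd]
              exact Real.rpow_le_rpow_of_exponent_ge ht h (by linarith)
            have h4 : η ≤ C4 / κ := by rw [le_div_iff₀ hκ]; linarith
            linarith
          · have : t ^ (-σ / 2) ≤ 1 := Real.rpow_le_one_of_one_le_of_nonpos h (by linarith)
            have : 0 < C4 / κ := by positivity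
            linarith
        have h3 : β * N ≤ β * Real.sqrt (t1 / τ0) := by gcongr
        linarith
      have h1 := hlim t htt
      have h2 : η * Real.sqrt t = t ^ (-((σ + 1) / 2)) := by
        rw [hηd, Real.sqrt_eq_rpow, ← Real.rpow_add ht]; congr 1; ring
      have h3 : ω ≤ Real.sqrt t / N := by
        rw [hω]
        have : Real.sqrt t / N = Real.sqrt τ := by
          rw [hτd, Real.sqrt_div ht.le, Real.sqrt_sq hN.le]
        rw [this]
        exact Real.sqrt_le_sqrt hc.le
      have h4 : e ≤ β * (Real.sqrt t / N) ^ 3 - σ * (η * Real.sqrt t) := by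
        have h5 : β * ω ^ 3 ≤ β * (Real.sqrt t / N) ^ 3 := by gcongr
        have h6 : σ * (η * Real.sqrt t) ≤ e := by
          rw [h2]
          calc σ * _ ≤ σ * (e / σ) := by gcongr
            _ = e := by field_simp
        have : β * ω ^ 3 = 2 * e := by rw [he]; ring
        linarith
      have h7 : αt = (β * (Real.sqrt t / N) ^ 3 - σ * (η * Real.sqrt t)) ^ 2 := by
        have : β * (Real.sqrt t / N) ^ 3 - σ * (η * Real.sqrt t) = (β * t / N ^ 3 - σ * η) * Real.sqrt t := by
          nth_rw 3 [← hrsq]; ring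
        rw [this, mul_pow, hrsq, ← hαt]
      have h8 : e ^ 2 ≤ αt := by rw [h7]; gcongr
      have h9 : C4 ≤ 1 / 2 * v * αt := by
        calc C4 = 1 / 2 * A2 * e ^ 2 := by rw [← hA2]; field_simp
          _ ≤ 1 / 2 * v * αt := by gcongr
      linarith

theorem ww_bdd {σ β a L K R : ℝ} (hσ : 0 < σ) (hβ : 0 < β) (ha : 0 < a) (hK : 0 ≤ K) :
    ∃ b ≥ (0 : ℝ), ∀ t N ζ Y QQ ww : ℝ, 0 < t → 0 < N → 0 ≤ ζ → N ^ 4 = t ^ 2 + a * ζ → 0 ≤ Y →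
      Y ≤ K * ζ * t → QQ ≤ K * ζ * Y →
      ww ≤ 3 * ((β * t / N ^ 3 - σ * t ^ (-σ / 2 - 1)) ^ 2 * t + L ^ 2 / N ^ 4 * Y +
          (L * (a / 8) / N ^ 4) ^ 2 * QQ) →
      β * N + t ^ (-σ / 2) ≤ R → ww ≤ b := by
  refine ⟨6 * β ^ 2 + 6 * σ ^ 2 * |R| ^ (2 * (σ + 1) / σ) + 3 * (1 + a * K / 64) * L ^ 2 * (K / a * (R / β) ^ 2),
    by positivity, ?_⟩
  intro t N ζ Y QQ ww ht hN hζ hP hY hYK hQ hww hs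
  have hww' := ww_le ha hN hP hK hY hQ hww
  have hτ := tau_le_one ha hN hζ hP
  have htσ : 0 < t ^ (-σ / 2) := Real.rpow_pos_of_pos ht _
  have hNR : N ≤ R / β := by rw [le_div_iff₀ hβ]; linarith
  have hz : a * ζ ≤ N ^ 4 := by nlinarith [sq_nonneg t]
  have htN : t ≤ N ^ 2 := by rwa [div_le_one (by positivity)] at hτ
  have h1 : Y / N ^ 4 ≤ K / a * (R / β) ^ 2 := by
    calc Y / N ^ 4 ≤ K * ζ * t / N ^ 4 := by gcongr
      _ = K / a * (t * (a * ζ / N ^ 4)) := by field_simp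
      _ ≤ K / a * (N ^ 2 * 1) := by
          gcongr
          rw [div_le_one (by positivity)]; exact hz
      _ ≤ K / a * (R / β) ^ 2 := by rw [mul_one]; gcongr
  have h2 : 3 * (1 + a * K / 64) * L ^ 2 * Y / N ^ 4 ≤ 3 * (1 + a * K / 64) * L ^ 2 * (K / a * (R / β) ^ 2) := by
    rw [mul_div_assoc]; gcongr
  have h3 : 3 * (β * t / N ^ 3 - σ * t ^ (-σ / 2 - 1)) ^ 2 * t ≤
      6 * β ^ 2 * (t ^ 3 / N ^ 6) + 6 * σ ^ 2 * ((t ^ (-σ / 2 - 1)) ^ 2 * t) := by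
    have : 6 * β ^ 2 * (t ^ 3 / N ^ 6) + 6 * σ ^ 2 * ((t ^ (-σ / 2 - 1)) ^ 2 * t)
      - 3 * (β * t / N ^ 3 - σ * t ^ (-σ / 2 - 1)) ^ 2 * t
      = 3 * (β * t / N ^ 3 + σ * t ^ (-σ / 2 - 1)) ^ 2 * t := by ring
    have h : 0 ≤ 3 * (β * t / N ^ 3 + σ * t ^ (-σ / 2 - 1)) ^ 2 * t := by positivity
    linarith
  have h4 : t ^ 3 / N ^ 6 ≤ 1 := by
    rw [div_le_one (by positivity)]
    calc t ^ 3 ≤ (N ^ 2) ^ 3 := by gcongr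
      _ = N ^ 6 := by ring
  have h5 : (t ^ (-σ / 2 - 1)) ^ 2 * t ≤ |R| ^ (2 * (σ + 1) / σ) := by
    have : (t ^ (-σ / 2 - 1)) ^ 2 * t = (t ^ (-σ / 2)) ^ (2 * (σ + 1) / σ) := by
      rw [← Real.rpow_natCast, ← Real.rpow_mul ht.le, ← Real.rpow_mul ht.le]
      nth_rw 2 [← Real.rpow_one t]
      rw [← Real.rpow_add ht]
      congr 1
      field_simp; push_cast; ring
    rw [this]
    apply Real.rpow_le_rpow htσ.le _ (by positivity)
    have : 0 < β * N := by positivity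
    exact le_trans (by linarith) (le_abs_self R)
  have h6 : 6 * β ^ 2 * (t ^ 3 / N ^ 6) ≤ 6 * β ^ 2 * 1 := by gcongr
  have h7 : 6 * σ ^ 2 * ((t ^ (-σ / 2 - 1)) ^ 2 * t) ≤ 6 * σ ^ 2 * |R| ^ (2 * (σ + 1) / σ) := by gcongr
  linarith

section carnotCalc
variable {n m : ℕ} (Λ : Fin m → Fin n → Fin n → ℝ)

noncomputable def uu (k : Fin m) (i : Fin n) (x : Fin n → ℝ) : ℝ := ∑ l, Λ k i l * x l
noncomputable def MM (z : Fin m → ℝ) (i l : Fin n) : ℝ := ∑ k, z k * Λ k i l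
noncomputable def yy (i : Fin n) (p : Pt n m) : ℝ := ∑ l, MM Λ p.2 i l * p.1 l
noncomputable def qq (i : Fin n) (p : Pt n m) : ℝ := ∑ l, MM Λ p.2 i l * yy Λ l p
noncomputable def tt (p : Pt n m) : ℝ := ∑ i, p.1 i ^ 2
noncomputable def zz (p : Pt n m) : ℝ := ∑ j, p.2 j ^ 2

noncomputable def vX (i : Fin n) (p : Pt n m) : Pt n m :=
  (Pi.single i 1, fun k => 1 / 2 * uu Λ k i p.1)

theorem X_eq (i : Fin n) (f : Pt n m → ℝ) (p : Pt n m) :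
    X Λ i f p = fderiv ℝ f p (vX Λ i p) := by
  have h : vX Λ i p = (Pi.single i 1, 0) +
      ∑ k, (1 / 2 * uu Λ k i p.1) • ((0 : Fin n → ℝ), (Pi.single k 1 : Fin m → ℝ)) := by
    ext j
    · simp [vX, Prod.fst_sum]
    · simp [vX, Prod.snd_sum, Pi.single_apply]
  rw [h, map_add, map_sum]
  simp only [map_smul, smul_eq_mul, X, uu, Finset.mul_sum, Finset.sum_mul]
  congr 1
  refine Finset.sum_congr rfl fun k _ => Finset.sum_congr rfl fun l _ => ?_
  ring

def HasX (i : Fin n) (f : Pt n m → ℝ) (p : Pt n m) (d : ℝ) : Prop :=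
  HasDerivAt (fun τ : ℝ => f (p + τ • vX Λ i p)) d 0

variable {Λ}

theorem HasX.of_diff {i : Fin n} {f : Pt n m → ℝ} {p : Pt n m} (h : DifferentiableAt ℝ f p) :
    HasX Λ i f p (X Λ i f p) := by
  rw [X_eq]
  exact h.hasFDerivAt.hasLineDerivAt _

theorem HasX.eq {i : Fin n} {f : Pt n m → ℝ} {p : Pt n m} {d : ℝ} (h : HasX Λ i f p d)
    (hf : DifferentiableAt ℝ f p) : X Λ i f p = d :=
  (HasX.of_diff hf).unique h

theorem HasX.mul {i : Fin n} {f g : Pt n m → ℝ} {p : Pt n m} {d e : ℝ} (hf : HasX Λ i f p d)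
    (hg : HasX Λ i g p e) : HasX Λ i (fun p => f p * g p) p (d * g p + f p * e) := by
  have := HasDerivAt.fun_mul hf hg
  simpa [HasX] using this

theorem HasX.add {i : Fin n} {f g : Pt n m → ℝ} {p : Pt n m} {d e : ℝ} (hf : HasX Λ i f p d)
    (hg : HasX Λ i g p e) : HasX Λ i (fun p => f p + g p) p (d + e) :=
  HasDerivAt.fun_add hf hg

theorem HasX.sub {i : Fin n} {f g : Pt n m → ℝ} {p : Pt n m} {d e : ℝ} (hf : HasX Λ i f p d)
    (hg : HasX Λ i g p e) : HasX Λ i (fun p => f p - g p) p (d - e) :=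
  HasDerivAt.fun_sub hf hg

theorem HasX.const (i : Fin n) (c : ℝ) (p : Pt n m) : HasX Λ i (fun _ => c) p 0 :=
  hasDerivAt_const _ _

theorem HasX.const_mul {i : Fin n} {f : Pt n m → ℝ} {p : Pt n m} {d : ℝ} (c : ℝ)
    (hf : HasX Λ i f p d) : HasX Λ i (fun p => c * f p) p (c * d) :=
  HasDerivAt.const_mul c hf

theorem HasX.sum {ι : Type*} {s : Finset ι} {i : Fin n} {f : ι → Pt n m → ℝ} {p : Pt n m}
    {d : ι → ℝ} (hf : ∀ j ∈ s, HasX Λ i (f j) p (d j)) :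
    HasX Λ i (fun p => ∑ j ∈ s, f j p) p (∑ j ∈ s, d j) :=
  HasDerivAt.fun_sum hf

theorem HasX.comp {i : Fin n} {f : Pt n m → ℝ} {p : Pt n m} {d : ℝ} {φ : ℝ → ℝ} {φ' : ℝ}
    (hφ : HasDerivAt φ φ' (f p)) (hf : HasX Λ i f p d) : HasX Λ i (fun p => φ (f p)) p (φ' * d) := by
  unfold HasX at *
  refine HasDerivAt.comp (h₂ := φ) (0 : ℝ) ?_ hf
  simpa using hφ

theorem HasX.hx (i j : Fin n) (p : Pt n m) : HasX Λ i (fun p => p.1 j) p (if j = i then 1 else 0) := by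
  unfold HasX
  have : (fun τ : ℝ => (p + τ • vX Λ i p).1 j) = fun τ => p.1 j + τ * (if j = i then 1 else 0) := by
    ext τ; simp [vX, Pi.single_apply]
  rw [this]
  simpa using ((hasDerivAt_id (0 : ℝ)).mul_const (if j = i then (1 : ℝ) else 0)).const_add (p.1 j)

theorem HasX.hz (i : Fin n) (k : Fin m) (p : Pt n m) :
    HasX Λ i (fun p => p.2 k) p (1 / 2 * uu Λ k i p.1) := by
  unfold HasX
  have : (fun τ : ℝ => (p + τ • vX Λ i p).2 k) = fun τ => p.2 k + τ * (1 / 2 * uu Λ k i p.1) := by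
    ext τ; simp [vX]
  rw [this]
  simpa using ((hasDerivAt_id (0 : ℝ)).mul_const (1 / 2 * uu Λ k i p.1)).const_add (p.2 k)

theorem HasX.congr_d {i : Fin n} {f : Pt n m → ℝ} {p : Pt n m} {d e : ℝ} (hf : HasX Λ i f p d)
    (h : d = e) : HasX Λ i f p e := h ▸ hf

theorem HasX.htt (i : Fin n) (p : Pt n m) : HasX Λ i tt p (2 * p.1 i) := by
  have h : ∀ j ∈ (Finset.univ : Finset (Fin n)), HasX Λ i (fun p => p.1 j ^ 2) p
      (2 * p.1 j * (if j = i then 1 else 0)) := fun j _ =>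
    (HasX.comp (φ := fun r => r ^ 2) (φ' := 2 * p.1 j) (by simpa using hasDerivAt_pow 2 (p.1 j)) (HasX.hx i j p))
  refine (HasX.sum h).congr_d ?_
  simp

theorem HasX.hzz (i : Fin n) (p : Pt n m) : HasX Λ i zz p (yy Λ i p) := by
  have h : ∀ k ∈ (Finset.univ : Finset (Fin m)), HasX Λ i (fun p => p.2 k ^ 2) p
      (2 * p.2 k * (1 / 2 * uu Λ k i p.1)) := fun k _ =>
    (HasX.comp (φ := fun r => r ^ 2) (φ' := 2 * p.2 k) (by simpa using hasDerivAt_pow 2 (p.2 k)) (HasX.hz i k p))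
  refine (HasX.sum h).congr_d ?_
  simp only [uu, yy, MM, Finset.mul_sum, Finset.sum_mul]
  rw [Finset.sum_comm]
  refine Finset.sum_congr rfl fun l _ => Finset.sum_congr rfl fun k _ => ?_
  ring

theorem HasX.hMM (i j l : Fin n) (p : Pt n m) :
    HasX Λ i (fun p => MM Λ p.2 j l) p (∑ k, 1 / 2 * uu Λ k i p.1 * Λ k j l) := by
  refine HasX.sum fun k _ => ?_
  refine ((HasX.hz i k p).mul (HasX.const i (Λ k j l) p)).congr_d ?_
  ring

theorem HasX.hyy (i j : Fin n) (p : Pt n m) :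
    HasX Λ i (yy Λ j) p ((∑ k, 1 / 2 * uu Λ k i p.1 * uu Λ k j p.1) + MM Λ p.2 j i) := by
  refine (HasX.sum fun l _ => (HasX.hMM i j l p).mul (HasX.hx i l p)).congr_d ?_
  rw [Finset.sum_add_distrib]
  congr 1
  · simp only [Finset.sum_mul]
    rw [Finset.sum_comm]
    refine Finset.sum_congr rfl fun k _ => ?_
    simp only [uu, Finset.mul_sum]
    refine Finset.sum_congr rfl fun l _ => ?_
    ring
  · simp

theorem HasX.hqq (i j : Fin n) (p : Pt n m) :
    HasX Λ i (qq Λ j) p (∑ l, ((∑ k, 1 / 2 * uu Λ k i p.1 * Λ k j l) * yy Λ l p +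
      MM Λ p.2 j l * ((∑ k, 1 / 2 * uu Λ k i p.1 * uu Λ k l p.1) + MM Λ p.2 l i))) :=
  HasX.sum fun l _ => (HasX.hMM i j l p).mul (HasX.hyy i l p)

-- scalar invariants
variable (Λ)
noncomputable def sY (p : Pt n m) : ℝ := ∑ i, yy Λ i p ^ 2
noncomputable def sU (p : Pt n m) : ℝ := ∑ k, ∑ i, uu Λ k i p.1 ^ 2
noncomputable def sG (p : Pt n m) : ℝ := ∑ k, ∑ i, uu Λ k i p.1 * (∑ l, Λ k i l * yy Λ l p)
noncomputable def sF (p : Pt n m) : ℝ := ∑ i, ∑ l, MM Λ p.2 i l ^ 2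
noncomputable def sQ (p : Pt n m) : ℝ := ∑ i, qq Λ i p ^ 2
noncomputable def KL : ℝ := ∑ k, ∑ i, ∑ l, Λ k i l ^ 2
variable {Λ}

theorem MM_skew (hskew : ∀ k i l, Λ k i l = -Λ k l i) (z : Fin m → ℝ) (i l : Fin n) :
    MM Λ z i l = - MM Λ z l i := by
  unfold MM
  rw [← Finset.sum_neg_distrib]
  refine Finset.sum_congr rfl fun k _ => ?_
  rw [hskew k i l]; ring

theorem skew_quad {A : Fin n → Fin n → ℝ} (hA : ∀ i l, A i l = - A l i) (v : Fin n → ℝ) :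
    ∑ i, ∑ l, v i * (A i l * v l) = 0 := by
  have h : ∑ i, ∑ l, v i * (A i l * v l) = - ∑ i, ∑ l, v i * (A i l * v l) := by
    conv_lhs => rw [Finset.sum_comm]
    rw [← Finset.sum_neg_distrib]
    refine Finset.sum_congr rfl fun l _ => ?_
    rw [← Finset.sum_neg_distrib]
    refine Finset.sum_congr rfl fun i _ => ?_
    rw [hA i l]; ring
  linarith


theorem sum_x_y (hskew : ∀ k i l, Λ k i l = -Λ k l i) (p : Pt n m) : ∑ i, p.1 i * yy Λ i p = 0 := by
  simp only [yy, Finset.mul_sum]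
  exact skew_quad (MM_skew hskew p.2) p.1

theorem sum_y_q (hskew : ∀ k i l, Λ k i l = -Λ k l i) (p : Pt n m) : ∑ i, yy Λ i p * qq Λ i p = 0 := by
  simp only [qq, Finset.mul_sum]
  exact skew_quad (MM_skew hskew p.2) (fun i => yy Λ i p)

theorem sum_x_q (hskew : ∀ k i l, Λ k i l = -Λ k l i) (p : Pt n m) : ∑ i, p.1 i * qq Λ i p = - sY Λ p := by
  simp only [qq, Finset.mul_sum, sY]
  rw [Finset.sum_comm, ← Finset.sum_neg_distrib]
  refine Finset.sum_congr rfl fun l _ => ?_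
  rw [pow_two]
  nth_rw 2 [yy]
  rw [Finset.sum_mul, ← Finset.sum_neg_distrib]
  refine Finset.sum_congr rfl fun i _ => ?_
  rw [MM_skew hskew p.2 i l]; ring

theorem sum_dy (hskew : ∀ k i l, Λ k i l = -Λ k l i) (p : Pt n m) :
    ∑ i, ((∑ k, 1 / 2 * uu Λ k i p.1 * uu Λ k i p.1) + MM Λ p.2 i i) = 1 / 2 * sU Λ p := by
  have h : ∀ i, MM Λ p.2 i i = 0 := fun i => by have := MM_skew hskew p.2 i i; linarith
  simp only [h, add_zero, sU, Finset.mul_sum]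
  rw [Finset.sum_comm]
  refine Finset.sum_congr rfl fun k _ => Finset.sum_congr rfl fun i _ => ?_
  ring

theorem sum_dq (hskew : ∀ k i l, Λ k i l = -Λ k l i) (p : Pt n m) :
    ∑ i, (∑ l, ((∑ k, 1 / 2 * uu Λ k i p.1 * Λ k i l) * yy Λ l p +
      MM Λ p.2 i l * ((∑ k, 1 / 2 * uu Λ k i p.1 * uu Λ k l p.1) + MM Λ p.2 l i)))
      = sG Λ p / 2 - sF Λ p := by
  have h1 : ∑ i, ∑ l, (∑ k, 1 / 2 * uu Λ k i p.1 * Λ k i l) * yy Λ l p = sG Λ p / 2 := by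
    simp only [sG, Finset.sum_mul, Finset.mul_sum, Finset.sum_div]
    conv_lhs => enter [2, i]; rw [Finset.sum_comm]
    rw [Finset.sum_comm]
    refine Finset.sum_congr rfl fun k _ => Finset.sum_congr rfl fun i _ =>
      Finset.sum_congr rfl fun l _ => ?_
    ring
  have h2 : ∑ i, ∑ l, MM Λ p.2 i l * (∑ k, 1 / 2 * uu Λ k i p.1 * uu Λ k l p.1) = 0 := by
    simp only [Finset.mul_sum]
    conv_lhs => enter [2, i]; rw [Finset.sum_comm]
    rw [Finset.sum_comm]
    refine Finset.sum_eq_zero fun k _ => ?_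
    have := skew_quad (MM_skew hskew p.2) (fun i => uu Λ k i p.1)
    calc _ = ∑ i, ∑ l, 1 / 2 * (uu Λ k i p.1 * (MM Λ p.2 i l * uu Λ k l p.1)) := by
          refine Finset.sum_congr rfl fun i _ => Finset.sum_congr rfl fun l _ => ?_
          ring
      _ = 1 / 2 * ∑ i, ∑ l, (uu Λ k i p.1 * (MM Λ p.2 i l * uu Λ k l p.1)) := by
          simp only [Finset.mul_sum]
      _ = 0 := by rw [this]; ring
  have h3 : ∑ i, ∑ l, MM Λ p.2 i l * MM Λ p.2 l i = - sF Λ p := by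
    simp only [sF, ← Finset.sum_neg_distrib]
    refine Finset.sum_congr rfl fun i _ => Finset.sum_congr rfl fun l _ => ?_
    rw [MM_skew hskew p.2 l i]; ring
  simp only [mul_add, Finset.sum_add_distrib]
  rw [h1, h2, h3]; ring

theorem sum_mul_sq_le {ι : Type*} [Fintype ι] (f g : ι → ℝ) :
    (∑ i, f i * g i) ^ 2 ≤ (∑ i, f i ^ 2) * ∑ i, g i ^ 2 :=
  Finset.sum_mul_sq_le_sq_mul_sq _ _ _

theorem sU_le (p : Pt n m) : sU Λ p ≤ KL Λ * tt p := by
  unfold sU KL tt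
  rw [Finset.sum_mul]
  refine Finset.sum_le_sum fun k _ => ?_
  rw [Finset.sum_mul]
  exact Finset.sum_le_sum fun i _ => sum_mul_sq_le _ _

theorem sF_le (p : Pt n m) : sF Λ p ≤ KL Λ * zz p := by
  unfold sF KL zz MM
  calc _ ≤ ∑ i, ∑ l, (∑ k, p.2 k ^ 2) * ∑ k, Λ k i l ^ 2 :=
        Finset.sum_le_sum fun i _ => Finset.sum_le_sum fun l _ => sum_mul_sq_le _ _
    _ = _ := by
        simp only [← Finset.mul_sum]
        rw [mul_comm]
        congr 1
        conv_lhs => enter [2, i]; rw [Finset.sum_comm]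
        rw [Finset.sum_comm]

theorem tt_nonneg (p : Pt n m) : 0 ≤ tt p := Finset.sum_nonneg fun _ _ => sq_nonneg _
theorem zz_nonneg (p : Pt n m) : 0 ≤ zz p := Finset.sum_nonneg fun _ _ => sq_nonneg _
theorem sY_nonneg (p : Pt n m) : 0 ≤ sY Λ p := Finset.sum_nonneg fun _ _ => sq_nonneg _
theorem KL_nonneg : 0 ≤ KL Λ := Finset.sum_nonneg fun _ _ => Finset.sum_nonneg fun _ _ =>
  Finset.sum_nonneg fun _ _ => sq_nonneg _

theorem sY_le (p : Pt n m) : sY Λ p ≤ KL Λ * zz p * tt p := by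
  calc sY Λ p ≤ sF Λ p * tt p := by
        unfold sY sF tt
        rw [Finset.sum_mul]
        exact Finset.sum_le_sum fun i _ => sum_mul_sq_le _ _
    _ ≤ _ := mul_le_mul_of_nonneg_right (sF_le p) (tt_nonneg p)

theorem sQ_le (p : Pt n m) : sQ Λ p ≤ KL Λ * zz p * sY Λ p := by
  calc sQ Λ p ≤ sF Λ p * sY Λ p := by
        unfold sQ sF
        rw [Finset.sum_mul]
        exact Finset.sum_le_sum fun i _ => sum_mul_sq_le _ _
    _ ≤ _ := mul_le_mul_of_nonneg_right (sF_le p) (sY_nonneg p)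

theorem sG_le (p : Pt n m) {N : ℝ} (hN : 0 < N) :
    sG Λ p ≤ (N ^ 2 * sU Λ p + KL Λ * sY Λ p / N ^ 2) / 2 := by
  have hH : ∑ k, ∑ i, (∑ l, Λ k i l * yy Λ l p) ^ 2 ≤ KL Λ * sY Λ p := by
    unfold KL
    rw [Finset.sum_mul]
    refine Finset.sum_le_sum fun k _ => ?_
    rw [Finset.sum_mul]
    exact Finset.sum_le_sum fun i _ => sum_mul_sq_le _ _
  have h1 : sG Λ p ≤ ∑ k, ∑ i, (N ^ 2 * uu Λ k i p.1 ^ 2 + (∑ l, Λ k i l * yy Λ l p) ^ 2 / N ^ 2) / 2 := by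
    unfold sG
    refine Finset.sum_le_sum fun k _ => Finset.sum_le_sum fun i _ => ?_
    set A := uu Λ k i p.1
    set B := ∑ l, Λ k i l * yy Λ l p
    have : (N ^ 2 * A ^ 2 + B ^ 2 / N ^ 2) / 2 - A * B = (N * A - B / N) ^ 2 / 2 := by
      field_simp; ring
    have h : 0 ≤ (N * A - B / N) ^ 2 / 2 := by positivity
    linarith
  have h2 : ∑ k, ∑ i, (N ^ 2 * uu Λ k i p.1 ^ 2 + (∑ l, Λ k i l * yy Λ l p) ^ 2 / N ^ 2) / 2
      = (N ^ 2 * sU Λ p + (∑ k, ∑ i, (∑ l, Λ k i l * yy Λ l p) ^ 2) / N ^ 2) / 2 := by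
    simp only [← Finset.sum_div, Finset.sum_add_distrib, ← Finset.mul_sum, sU]
  rw [h2] at h1
  refine h1.trans ?_
  gcongr

theorem exists_c0 (hLI : LinearIndependent ℝ Λ) :
    ∃ c0 > (0 : ℝ), ∀ p : Pt n m, c0 * zz p ≤ sF Λ p := by
  set T : (Fin m → ℝ) →ₗ[ℝ] (Fin n → Fin n → ℝ) := Fintype.linearCombination ℝ Λ with hT
  have hinj : Function.Injective T := hLI.fintypeLinearCombination_injective
  obtain ⟨K, hK, hanti⟩ := T.exists_antilipschitzWith (LinearMap.ker_eq_bot.2 hinj)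
  have hT2 : ∀ z, T z = MM Λ z := by
    intro z
    ext i l
    simp [hT, Fintype.linearCombination_apply, MM, Finset.sum_apply]
  refine ⟨1 / ((m + 1) * K ^ 2), by positivity, fun p => ?_⟩
  have h1 : ‖p.2‖ ≤ K * ‖T p.2‖ := by
    have := hanti.le_mul_dist p.2 0
    simpa using this
  have h2 : zz p ≤ m * ‖p.2‖ ^ 2 := by
    unfold zz
    calc _ ≤ ∑ j : Fin m, ‖p.2‖ ^ 2 := Finset.sum_le_sum fun j _ => by
          rw [← sq_abs]
          have : |p.2 j| ≤ ‖p.2‖ := norm_le_pi_norm p.2 j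
          gcongr
      _ = _ := by simp
  have h3 : ‖T p.2‖ ^ 2 ≤ sF Λ p := by
    have hF0 : 0 ≤ sF Λ p := Finset.sum_nonneg fun _ _ => Finset.sum_nonneg fun _ _ => sq_nonneg _
    have : ‖T p.2‖ ≤ Real.sqrt (sF Λ p) := by
      rw [pi_norm_le_iff_of_nonneg (Real.sqrt_nonneg _)]
      intro i
      rw [pi_norm_le_iff_of_nonneg (Real.sqrt_nonneg _)]
      intro l
      rw [hT2]
      apply Real.le_sqrt_of_sq_le
      rw [Real.norm_eq_abs, sq_abs]
      unfold sF
      calc MM Λ p.2 i l ^ 2 ≤ ∑ l, MM Λ p.2 i l ^ 2 :=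
            Finset.single_le_sum (f := fun l => MM Λ p.2 i l ^ 2) (fun _ _ => sq_nonneg _) (Finset.mem_univ l)
        _ ≤ _ := Finset.single_le_sum (f := fun i => ∑ l, MM Λ p.2 i l ^ 2) (fun _ _ => Finset.sum_nonneg fun _ _ => sq_nonneg _) (Finset.mem_univ i)
    calc _ ≤ Real.sqrt (sF Λ p) ^ 2 := by gcongr
      _ = _ := Real.sq_sqrt hF0
  rw [one_div, inv_mul_le_iff₀ (by positivity)]
  calc zz p ≤ m * ‖p.2‖ ^ 2 := h2
    _ ≤ (m + 1) * (K * ‖T p.2‖) ^ 2 := by gcongr; linarith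
    _ = (m + 1) * K ^ 2 * ‖T p.2‖ ^ 2 := by ring
    _ ≤ _ := by gcongr
end carnotCalc

section carnotField
variable {n m : ℕ} {Λ : Fin m → Fin n → Fin n → ℝ}

/-- argument of `V` -/
noncomputable def ss (a β σ : ℝ) (p : Pt n m) : ℝ := β * Nrm a p + xnorm p ^ (-σ)

theorem Nrm_eq (a : ℝ) (p : Pt n m) : Nrm a p = (tt p ^ 2 + a * zz p) ^ ((1 : ℝ) / 4) := rfl

theorem xnorm_rpow (σ : ℝ) (p : Pt n m) : xnorm p ^ (-σ) = tt p ^ (-σ / 2) := by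
  show (Real.sqrt (tt p)) ^ _ = _
  rw [Real.sqrt_eq_rpow, ← Real.rpow_mul (tt_nonneg p)]
  congr 1; ring

theorem Nrm_pow4 {a : ℝ} (ha : 0 < a) (p : Pt n m) : Nrm a p ^ 4 = tt p ^ 2 + a * zz p := by
  rw [Nrm_eq]
  have h : 0 ≤ tt p ^ 2 + a * zz p := by have := zz_nonneg p; positivity
  rw [← Real.rpow_natCast, ← Real.rpow_mul h]; norm_num

theorem rad_pos {a : ℝ} (ha : 0 < a) {p : Pt n m} (hp : 0 < tt p) : 0 < tt p ^ 2 + a * zz p := by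
  have := zz_nonneg p; positivity

theorem Nrm_pos {a : ℝ} (ha : 0 < a) {p : Pt n m} (hp : 0 < tt p) : 0 < Nrm a p :=
  Real.rpow_pos_of_pos (rad_pos ha hp) _

theorem HasX.hNrm {a : ℝ} (ha : 0 < a) {p : Pt n m} (hp : 0 < tt p) (i : Fin n) :
    HasX Λ i (Nrm a) p ((4 * tt p * p.1 i + a * yy Λ i p) / (4 * Nrm a p ^ 3)) := by
  have h0 := rad_pos ha hp
  have h1 : HasX Λ i (fun p => tt p ^ 2 + a * zz p) p (2 * tt p * (2 * p.1 i) + a * yy Λ i p) :=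
    (HasX.comp (φ := fun r => r ^ 2) (φ' := 2 * tt p) (by simpa using hasDerivAt_pow 2 (tt p))
      (HasX.htt i p)).add ((HasX.hzz i p).const_mul a)
  have h2 := HasX.comp (φ := fun r => r ^ ((1 : ℝ) / 4))
    (Real.hasDerivAt_rpow_const (p := (1 : ℝ) / 4) (Or.inl h0.ne')) h1
  refine h2.congr_d ?_
  have h3 : (tt p ^ 2 + a * zz p) ^ ((1 : ℝ) / 4 - 1) = 1 / Nrm a p ^ 3 := by
    rw [Nrm_eq]
    generalize tt p ^ 2 + a * zz p = w at h0
    rw [← Real.rpow_natCast, ← Real.rpow_mul h0.le, one_div (w ^ _), ← Real.rpow_neg h0.le]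
    norm_num
  rw [h3]
  have := Nrm_pos ha hp
  field_simp
  ring

theorem HasX.hrpow {p : Pt n m} (hp : 0 < tt p) (r : ℝ) (i : Fin n) :
    HasX Λ i (fun p => tt p ^ r) p (2 * r * tt p ^ (r - 1) * p.1 i) := by
  refine (HasX.comp (φ := fun x => x ^ r)
    (Real.hasDerivAt_rpow_const (p := r) (Or.inl hp.ne')) (HasX.htt i p)).congr_d ?_
  ring

theorem HasX.hss {a β σ : ℝ} (ha : 0 < a) {p : Pt n m} (hp : 0 < tt p) (i : Fin n) :
    HasX Λ i (ss a β σ) p ((β * tt p / Nrm a p ^ 3 - σ * tt p ^ (-σ / 2 - 1)) * p.1 i +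
      β * a / (4 * Nrm a p ^ 3) * yy Λ i p) := by
  have h : (ss a β σ : Pt n m → ℝ) = fun p => β * Nrm a p + tt p ^ (-σ / 2) := by
    ext p; simp [ss, xnorm_rpow]
  rw [h]
  refine (((HasX.hNrm ha hp i).const_mul β).add (HasX.hrpow hp (-σ / 2) i)).congr_d ?_
  have := Nrm_pos ha hp
  field_simp
  ring

variable (Λ)
/-- the auxiliary horizontal vector field -/
noncomputable def WW (a β σ L : ℝ) (i : Fin n) (p : Pt n m) : ℝ :=
  (β * tt p / Nrm a p ^ 3 - σ * tt p ^ (-σ / 2 - 1)) * p.1 i + L / Nrm a p ^ 2 * yy Λ i p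
    + L * (a / 8) / Nrm a p ^ 4 * qq Λ i p

/-- X_i derivative of WW_i -/
noncomputable def dWW (a β σ L : ℝ) (i : Fin n) (p : Pt n m) : ℝ :=
  (β * (2 * p.1 i) / Nrm a p ^ 3
      - 3 * β * tt p / Nrm a p ^ 4 * ((4 * tt p * p.1 i + a * yy Λ i p) / (4 * Nrm a p ^ 3))
      - σ * (2 * (-σ / 2 - 1) * tt p ^ (-σ / 2 - 1 - 1) * p.1 i)) * p.1 i
    + (β * tt p / Nrm a p ^ 3 - σ * tt p ^ (-σ / 2 - 1)) * 1
    + (-(2 * L / Nrm a p ^ 3) * ((4 * tt p * p.1 i + a * yy Λ i p) / (4 * Nrm a p ^ 3)) * yy Λ i p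
      + L / Nrm a p ^ 2 * ((∑ k, 1 / 2 * uu Λ k i p.1 * uu Λ k i p.1) + MM Λ p.2 i i))
    + (-(4 * (L * (a / 8)) / Nrm a p ^ 5) * ((4 * tt p * p.1 i + a * yy Λ i p) / (4 * Nrm a p ^ 3)) * qq Λ i p
      + L * (a / 8) / Nrm a p ^ 4 * (∑ l, ((∑ k, 1 / 2 * uu Λ k i p.1 * Λ k i l) * yy Λ l p +
      MM Λ p.2 i l * ((∑ k, 1 / 2 * uu Λ k i p.1 * uu Λ k l p.1) + MM Λ p.2 l i))))
variable {Λ}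

theorem hasDeriv_divpow (c N : ℝ) (hN : 0 < N) (j : ℕ) :
    HasDerivAt (fun N : ℝ => c / N ^ j) (-(j * c / N ^ (j + 1))) N := by
  have h := ((hasDerivAt_pow j N).inv (pow_ne_zero j hN.ne')).const_mul c
  have e : (fun N : ℝ => c / N ^ j) = fun y => c * (fun x : ℝ => x ^ j)⁻¹ y := by
    ext y; simp [div_eq_mul_inv]
  rw [e]
  refine h.congr_deriv ?_
  rcases j with _ | j
  · simp
  · simp; field_simp; ring

theorem HasX.hWW {a β σ L : ℝ} (ha : 0 < a) {p : Pt n m} (hp : 0 < tt p) (i : Fin n) :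
    HasX Λ i (WW Λ a β σ L i) p (dWW Λ a β σ L i p) := by
  have hN := Nrm_pos ha hp
  have hd := HasX.hNrm (Λ := Λ) ha hp i
  have h3 := HasX.comp (φ := fun N => 1 / N ^ 3) (hasDeriv_divpow 1 _ hN 3) hd
  have h2 := HasX.comp (φ := fun N => L / N ^ 2) (hasDeriv_divpow L _ hN 2) hd
  have h4 := HasX.comp (φ := fun N => L * (a / 8) / N ^ 4) (hasDeriv_divpow (L * (a / 8)) _ hN 4) hd
  have A := (((((HasX.htt i p).const_mul β).mul h3).sub ((HasX.hrpow hp (-σ / 2 - 1) i).const_mul σ)).mul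
    (HasX.hx i i p)).add (h2.mul (HasX.hyy i i p)) |>.add (h4.mul (HasX.hqq i i p))
  have e : (WW Λ a β σ L i) = fun p => (β * tt p * (1 / Nrm a p ^ 3) - σ * tt p ^ (-σ / 2 - 1)) * p.1 i + L / Nrm a p ^ 2 * yy Λ i p
    + L * (a / 8) / Nrm a p ^ 4 * qq Λ i p := by
    ext p; unfold WW; ring
  rw [e]
  refine A.congr_d ?_
  unfold dWW
  simp only [if_true]
  push_cast
  ring

theorem sum_dWW (hskew : ∀ k i l, Λ k i l = -Λ k l i) {a β σ L : ℝ} (ha : 0 < a) {p : Pt n m} (hp : 0 < tt p) :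
    ∑ i, dWW Λ a β σ L i p = divE n σ β a L (tt p) (Nrm a p) (sY Λ p) (sU Λ p) (sG Λ p) (sF Λ p)
      (tt p ^ (-σ / 2 - 1)) := by
  have hN := Nrm_pos ha hp
  set t := tt p with ht
  set N := Nrm a p with hNd
  set η := tt p ^ (-σ / 2 - 1) with hη
  have hη2 : t ^ (-σ / 2 - 1 - 1) = η / t := by
    rw [hη, Real.rpow_sub_one hp.ne' (-σ / 2 - 1)]
  have e : ∀ i, dWW Λ a β σ L i p =
      (2 * β / N ^ 3 - 3 * β * t ^ 2 / N ^ 7 + σ * (σ + 2) * (η / t)) * p.1 i ^ 2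
      + (-(3 * β * t * a / (4 * N ^ 7)) - 2 * L * t / N ^ 6) * (p.1 i * yy Λ i p)
      + (-(L * a / (2 * N ^ 6))) * (yy Λ i p ^ 2)
      + (-(L * a * t / (2 * N ^ 8))) * (p.1 i * qq Λ i p)
      + (-(L * (a ^ 2 / 8) / N ^ 8)) * (yy Λ i p * qq Λ i p)
      + (β * t / N ^ 3 - σ * η)
      + L / N ^ 2 * ((∑ k, 1 / 2 * uu Λ k i p.1 * uu Λ k i p.1) + MM Λ p.2 i i)
      + L * (a / 8) / N ^ 4 * (∑ l, ((∑ k, 1 / 2 * uu Λ k i p.1 * Λ k i l) * yy Λ l p +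
      MM Λ p.2 i l * ((∑ k, 1 / 2 * uu Λ k i p.1 * uu Λ k l p.1) + MM Λ p.2 l i))) := by
    intro i
    unfold dWW
    rw [← ht, ← hNd, ← hη, hη2]
    set D1 := (∑ k, 1 / 2 * uu Λ k i p.1 * uu Λ k i p.1) + MM Λ p.2 i i
    set D2 := ∑ l, ((∑ k, 1 / 2 * uu Λ k i p.1 * Λ k i l) * yy Λ l p +
      MM Λ p.2 i l * ((∑ k, 1 / 2 * uu Λ k i p.1 * uu Λ k l p.1) + MM Λ p.2 l i))
    have ht0 : t ≠ 0 := hp.ne'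
    field_simp
    ring
  simp only [e]
  rw [Finset.sum_add_distrib, Finset.sum_add_distrib, Finset.sum_add_distrib, Finset.sum_add_distrib,
    Finset.sum_add_distrib, Finset.sum_add_distrib, Finset.sum_add_distrib]
  rw [← Finset.mul_sum, ← Finset.mul_sum, ← Finset.mul_sum, ← Finset.mul_sum, ← Finset.mul_sum,
    ← Finset.mul_sum, ← Finset.mul_sum, sum_x_y hskew, sum_y_q hskew, sum_x_q hskew, sum_dy hskew,
    sum_dq hskew]
  have h1 : ∑ i, p.1 i ^ 2 = t := rfl
  have h2 : ∑ i, yy Λ i p ^ 2 = sY Λ p := rfl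
  rw [h1, h2]
  unfold divE
  simp only [Finset.sum_const, Finset.card_univ, Fintype.card_fin, nsmul_eq_mul]
  have ht0 : t ≠ 0 := hp.ne'
  field_simp
  ring

theorem sum_WW_ss (hskew : ∀ k i l, Λ k i l = -Λ k l i) {a β σ L : ℝ} (p : Pt n m) :
    ∑ i, WW Λ a β σ L i p * ((β * tt p / Nrm a p ^ 3 - σ * tt p ^ (-σ / 2 - 1)) * p.1 i +
      β * a / (4 * Nrm a p ^ 3) * yy Λ i p) = wsE σ β a L (tt p) (Nrm a p) (sY Λ p) (tt p ^ (-σ / 2 - 1)) := by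
  set t := tt p with ht
  set N := Nrm a p with hNd
  set α := (β * t / N ^ 3 - σ * t ^ (-σ / 2 - 1)) with hα
  have e : ∀ i, WW Λ a β σ L i p * (α * p.1 i + β * a / (4 * N ^ 3) * yy Λ i p) =
     α ^ 2 * p.1 i ^ 2 + (α * (β * a / (4 * N ^ 3)) + L / N ^ 2 * α) * (p.1 i * yy Λ i p)
     + L / N ^ 2 * (β * a / (4 * N ^ 3)) * yy Λ i p ^ 2
     + L * (a / 8) / N ^ 4 * α * (p.1 i * qq Λ i p)
     + L * (a / 8) / N ^ 4 * (β * a / (4 * N ^ 3)) * (yy Λ i p * qq Λ i p) := by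
    intro i
    unfold WW
    rw [← ht, ← hNd, ← hα]
    ring
  simp only [e]
  rw [Finset.sum_add_distrib, Finset.sum_add_distrib, Finset.sum_add_distrib, Finset.sum_add_distrib]
  rw [← Finset.mul_sum, ← Finset.mul_sum, ← Finset.mul_sum, ← Finset.mul_sum, ← Finset.mul_sum,
    sum_x_y hskew, sum_y_q hskew, sum_x_q hskew]
  have h1 : ∑ i, p.1 i ^ 2 = t := rfl
  have h2 : ∑ i, yy Λ i p ^ 2 = sY Λ p := rfl
  rw [h1, h2]
  unfold wsE
  rw [← hα]
  ring

theorem sum_WW_sq {a β σ L : ℝ} (p : Pt n m) :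
    ∑ i, WW Λ a β σ L i p ^ 2 ≤ 3 * ((β * tt p / Nrm a p ^ 3 - σ * tt p ^ (-σ / 2 - 1)) ^ 2 * tt p
      + L ^ 2 / Nrm a p ^ 4 * sY Λ p + (L * (a / 8) / Nrm a p ^ 4) ^ 2 * sQ Λ p) := by
  set t := tt p with ht
  set N := Nrm a p with hNd
  set α := (β * t / N ^ 3 - σ * t ^ (-σ / 2 - 1)) with hα
  have h1 : ∑ i, p.1 i ^ 2 = t := rfl
  have h2 : ∑ i, yy Λ i p ^ 2 = sY Λ p := rfl
  have h3 : ∑ i, qq Λ i p ^ 2 = sQ Λ p := rfl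
  rw [← h1, ← h2, ← h3, Finset.mul_sum, Finset.mul_sum, Finset.mul_sum, ← Finset.sum_add_distrib,
    ← Finset.sum_add_distrib, Finset.mul_sum]
  refine Finset.sum_le_sum fun i _ => ?_
  unfold WW
  rw [← ht, ← hNd, ← hα]
  set A := α * p.1 i
  set B := L / N ^ 2 * yy Λ i p with hB
  set C := L * (a / 8) / N ^ 4 * qq Λ i p with hC
  have e1 : α ^ 2 * p.1 i ^ 2 = A ^ 2 := by ring
  have e2 : L ^ 2 / N ^ 4 * yy Λ i p ^ 2 = B ^ 2 := by rw [hB]; ring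
  have e3 : (L * (a / 8) / N ^ 4) ^ 2 * qq Λ i p ^ 2 = C ^ 2 := by rw [hC]; ring
  rw [e1, e2, e3]
  nlinarith [sq_nonneg (A - B), sq_nonneg (A - C), sq_nonneg (B - C)]

theorem scal_pt {a : ℝ} (ha : 0 < a) {c0 : ℝ} (hc : ∀ p : Pt n m, c0 * zz p ≤ sF Λ p) {p : Pt n m} (hp : 0 < tt p) :
    Scal a (KL Λ) c0 (tt p) (Nrm a p) (zz p) (sY Λ p) (sU Λ p) (sG Λ p) (sF Λ p) :=
  ⟨hp, Nrm_pos ha hp, zz_nonneg p, Nrm_pow4 ha p, sY_nonneg p, sY_le p, sU_le p,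
    sG_le p (Nrm_pos ha hp), hc p⟩

theorem contDiff_tt : ContDiff ℝ ⊤ (tt : Pt n m → ℝ) := by unfold tt; fun_prop
theorem contDiff_zz : ContDiff ℝ ⊤ (zz : Pt n m → ℝ) := by unfold zz; fun_prop
theorem contDiff_yy (i : Fin n) : ContDiff ℝ ⊤ (yy Λ i) := by unfold yy MM; fun_prop
theorem contDiff_qq (i : Fin n) : ContDiff ℝ ⊤ (qq Λ i) := by
  unfold qq MM
  have := contDiff_yy (Λ := Λ)
  fun_prop

theorem cd_Nrm {a : ℝ} (ha : 0 < a) {p : Pt n m} (hp : 0 < tt p) : ContDiffAt ℝ 1 (Nrm a) p := by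
  have : (Nrm a : Pt n m → ℝ) = fun p => (tt p ^ 2 + a * zz p) ^ ((1 : ℝ) / 4) := rfl
  rw [this]
  refine ContDiffAt.rpow_const_of_ne ?_ (rad_pos ha hp).ne'
  have h1 := (contDiff_tt (n := n) (m := m)).of_le (m := 1) le_top |>.contDiffAt (x := p)
  have h2 := (contDiff_zz (n := n) (m := m)).of_le (m := 1) le_top |>.contDiffAt (x := p)
  fun_prop

theorem cd_rpow {p : Pt n m} (r : ℝ) (hp : 0 < tt p) : ContDiffAt ℝ 1 (fun p => tt p ^ r) p :=
  ContDiffAt.rpow_const_of_ne ((contDiff_tt (n := n) (m := m)).of_le (m := 1) le_top |>.contDiffAt (x := p)) hp.ne'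

theorem cd_ss {a β σ : ℝ} (ha : 0 < a) {p : Pt n m} (hp : 0 < tt p) : ContDiffAt ℝ 1 (ss a β σ) p := by
  have h : (ss a β σ : Pt n m → ℝ) = fun p => β * Nrm a p + tt p ^ (-σ / 2) := by
    ext p; simp [ss, xnorm_rpow]
  rw [h]
  exact (contDiffAt_const.mul (cd_Nrm ha hp)).add (cd_rpow _ hp)

theorem cd_WW {a β σ L : ℝ} (ha : 0 < a) {p : Pt n m} (hp : 0 < tt p) (i : Fin n) :
    ContDiffAt ℝ 1 (WW Λ a β σ L i) p := by
  have h1 := (contDiff_tt (n := n) (m := m)).of_le (m := 1) le_top |>.contDiffAt (x := p)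
  have h2 := (contDiff_yy (Λ := Λ) i).of_le (m := 1) le_top |>.contDiffAt (x := p)
  have h3 := (contDiff_qq (Λ := Λ) i).of_le (m := 1) le_top |>.contDiffAt (x := p)
  have hN := cd_Nrm ha hp
  have hN0 := Nrm_pos ha hp
  have h4 := cd_rpow (-σ / 2 - 1) hp
  unfold WW
  refine ContDiffAt.add (ContDiffAt.add (ContDiffAt.mul (ContDiffAt.sub (ContDiffAt.div (by fun_prop) (hN.pow 3) (by positivity)) (contDiffAt_const.mul h4)) (by fun_prop))
    (ContDiffAt.mul (ContDiffAt.div contDiffAt_const (hN.pow 2) (by positivity)) h2)) (ContDiffAt.mul (ContDiffAt.div contDiffAt_const (hN.pow 4) (by positivity)) h3)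
end carnotField

section carnotUbound
variable {n m : ℕ} {Λ : Fin m → Fin n → Fin n → ℝ}

instance instHaarPt : (volume : Measure (Pt n m)).IsAddHaarMeasure :=
  Measure.prod.instIsAddHaarMeasure _ _

theorem X_cont_int {F : Pt n m → ℝ} (hF : ContDiff ℝ 1 F) (i : Fin n) : Continuous (X Λ i F) := by
  have h := hF.continuous_fderiv (by norm_num)
  unfold X
  fun_prop

theorem X_supp {F : Pt n m → ℝ} (hc : HasCompactSupport F) (i : Fin n) :
    HasCompactSupport (X Λ i F) := by
  refine (hc.fderiv (𝕜 := ℝ)).mono' ?_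
  intro p hp
  refine subset_closure ?_
  intro h0
  apply hp
  rw [X_eq, h0]; simp

theorem integral_X {F : Pt n m → ℝ} (hF : ContDiff ℝ 1 F) (hc : HasCompactSupport F) (i : Fin n) :
    Integrable (X Λ i F) ∧ ∫ p, X Λ i F p = 0 := by
  have hcont := hF.continuous_fderiv (by norm_num)
  have hd := hF.differentiable (by norm_num)
  have key : ∀ (w : Pt n m → ℝ) (v : Pt n m), ContDiff ℝ 1 w → (∀ p, fderiv ℝ w p v = 0) →
      Integrable (fun p => w p * fderiv ℝ F p v) ∧ ∫ p, w p * fderiv ℝ F p v = 0 := by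
    intro w v hw hv
    have hwc := hw.continuous
    have i1 : Integrable (fun p => w p * fderiv ℝ F p v) := by
      refine Continuous.integrable_of_hasCompactSupport (by fun_prop) ?_
      exact (hc.fderiv_apply (𝕜 := ℝ) v).mul_left
    refine ⟨i1, ?_⟩
    rw [integral_mul_fderiv_eq_neg_fderiv_mul_of_integrable]
    · simp [hv]
    · simp [hv]
    · exact i1
    · exact Continuous.integrable_of_hasCompactSupport (hwc.mul hF.continuous) hc.mul_left
    · intro x _; exact (hw.differentiable (by norm_num)) x
    · intro x _; exact hd x
  have k1 := key (fun _ => 1) (Pi.single i 1, 0) contDiff_const (by simp)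
  have k2 : ∀ (k : Fin m) (l : Fin n), _ := fun k l => key (fun p => Λ k i l * p.1 l) (0, Pi.single k 1) (by fun_prop) (by
    intro p
    have h : (fun p : Pt n m => Λ k i l * p.1 l) = (Λ k i l • ((ContinuousLinearMap.proj l).comp (ContinuousLinearMap.fst ℝ (Fin n → ℝ) (Fin m → ℝ))) : Pt n m →L[ℝ] ℝ) := by
      ext p; simp
    rw [h, ContinuousLinearMap.fderiv]; simp)
  simp only [one_mul] at k1
  have i2 : Integrable (fun p => (1 / 2) * ∑ k : Fin m, ∑ l : Fin n,
      Λ k i l * p.1 l * fderiv ℝ F p (0, Pi.single k 1)) :=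
    (integrable_finsetSum _ fun k _ => integrable_finsetSum _ fun l _ => (k2 k l).1).const_mul _
  refine ⟨k1.1.add i2, ?_⟩
  unfold X
  rw [integral_add k1.1 i2, k1.2, integral_const_mul, integral_finsetSum]
  · simp_rw [integral_finsetSum _ fun l _ => (k2 _ l).1, fun k l => (k2 k l).2]
    simp
  · exact fun k _ => integrable_finsetSum _ fun l _ => (k2 k l).1

theorem null_tt (hn : 0 < n) : ∀ᵐ p : Pt n m, 0 < tt p := by
  set φ : Pt n m →ₗ[ℝ] ℝ := (LinearMap.proj (⟨0, hn⟩ : Fin n)).comp (LinearMap.fst ℝ (Fin n → ℝ) (Fin m → ℝ)) with hφ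
  have h : volume (LinearMap.ker φ : Set (Pt n m)) = 0 := by
    apply Measure.addHaar_submodule
    intro h
    rw [LinearMap.ker_eq_top] at h
    have := congrArg (fun ψ => ψ (Pi.single ⟨0, hn⟩ 1, 0)) h
    simp [hφ] at this
  have h2 : ∀ᵐ p : Pt n m, p ∉ (LinearMap.ker φ : Set (Pt n m)) := measure_eq_zero_iff_ae_notMem.1 h
  filter_upwards [h2] with p hp
  have h3 : p.1 ⟨0, hn⟩ ≠ 0 := by simpa [hφ] using hp
  calc 0 < p.1 ⟨0, hn⟩ ^ 2 := by positivity
    _ ≤ tt p := Finset.single_le_sum (f := fun i => p.1 i ^ 2) (fun _ _ => sq_nonneg _) (Finset.mem_univ _)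

theorem Nrm_nonneg {a : ℝ} (ha : 0 < a) (p : Pt n m) : 0 ≤ Nrm a p := by
  have := zz_nonneg p
  rw [Nrm_eq]; positivity

theorem norm_le_of_Nrm {a B : ℝ} (ha : 0 < a) {p : Pt n m} (h : Nrm a p ≤ B) :
    ‖p‖ ≤ B + B ^ 2 / √a := by
  have h0 := Nrm_nonneg ha p
  have hB : 0 ≤ B := h0.trans h
  have h4 := Nrm_pow4 ha p
  have hz := zz_nonneg p
  have ht := tt_nonneg p
  have hB4 : Nrm a p ^ 4 ≤ B ^ 4 := by gcongr
  have hsa : 0 < √a := Real.sqrt_pos.2 ha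
  have hsq : √a ^ 2 = a := Real.sq_sqrt ha.le
  have h1 : tt p ≤ B ^ 2 := by
    apply le_of_sq_le_sq _ (by positivity)
    nlinarith [mul_nonneg ha.le hz]
  have h2 : zz p ≤ (B ^ 2 / √a) ^ 2 := by
    rw [div_pow, hsq, le_div_iff₀ ha]
    nlinarith
  rw [Prod.norm_def]
  apply max_le
  · refine le_trans ?_ (le_add_of_nonneg_right (by positivity))
    rw [pi_norm_le_iff_of_nonneg hB]
    intro i
    have : p.1 i ^ 2 ≤ tt p := Finset.single_le_sum (f := fun i => p.1 i ^ 2) (fun _ _ => sq_nonneg _) (Finset.mem_univ i)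
    exact abs_le_of_sq_le_sq (this.trans h1) hB
  · refine le_trans ?_ (le_add_of_nonneg_left hB)
    rw [pi_norm_le_iff_of_nonneg (by positivity)]
    intro i
    have : p.2 i ^ 2 ≤ zz p := Finset.single_le_sum (f := fun i => p.2 i ^ 2) (fun _ _ => sq_nonneg _) (Finset.mem_univ i)
    exact abs_le_of_sq_le_sq (this.trans h2) (by positivity)

theorem small_t {σ : ℝ} (hσ : 0 < σ) (k : ℝ) : ∃ δ > 0, ∀ t : ℝ, 0 < t → t < δ → k ≤ t ^ (-σ / 2) := by
  have h := tendsto_rpow_neg_nhdsGT_zero (y := -σ / 2) (by linarith)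
  have h2 := h.eventually_ge_atTop k
  rw [eventually_nhdsWithin_iff, Metric.eventually_nhds_iff] at h2
  obtain ⟨δ, hδ, h2⟩ := h2
  exact ⟨δ, hδ, fun t ht htδ => h2 (by simpa [abs_of_pos ht] using htδ) ht⟩

theorem ss_ge {a β σ : ℝ} (ha : 0 < a) (hβ : 0 < β) (p : Pt n m) : tt p ^ (-σ / 2) ≤ ss a β σ p := by
  unfold ss
  rw [xnorm_rpow]
  have := Nrm_nonneg ha p
  have : 0 ≤ β * Nrm a p := by positivity
  linarith

theorem ss_pos {a β σ : ℝ} (ha : 0 < a) (hβ : 0 < β) {p : Pt n m} (hp : 0 < tt p) : 0 < ss a β σ p :=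
  lt_of_lt_of_le (Real.rpow_pos_of_pos hp _) (ss_ge ha hβ p)

theorem cd_V {V V' V'' : ℝ → ℝ} (hV' : ∀ s > (0 : ℝ), HasDerivAt V (V' s) s)
    (hV'' : ∀ s > (0 : ℝ), HasDerivAt V' (V'' s) s) {s : ℝ} (hs : 0 < s) : ContDiffAt ℝ 1 V s := by
  have h : ContDiffOn ℝ 1 V (Set.Ioi 0) := by
    have := (contDiffOn_succ_iff_deriv_of_isOpen (𝕜 := ℝ) (f := V) (n := 0) (s := Set.Ioi (0:ℝ)) isOpen_Ioi).2
    rw [zero_add] at this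
    refine this ⟨fun s hs => (hV' s hs).differentiableAt.differentiableWithinAt, by simp, ?_⟩
    rw [contDiffOn_zero]
    have h1 : ContinuousOn V' (Set.Ioi 0) := fun s hs => (hV'' s hs).continuousAt.continuousWithinAt
    exact h1.congr fun s hs => (hV' s hs).deriv
  exact h.contDiffAt (Ioi_mem_nhds hs)

/-- cutoff -/
noncomputable def chi (k : ℝ) (s : ℝ) : ℝ := Real.smoothTransition (k + 1 - s)

theorem chi_cd (k : ℝ) : ContDiff ℝ 1 (chi k) := by
  unfold chi
  exact (Real.smoothTransition.contDiff (n := 1)).comp (by fun_prop)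

theorem chi_deriv (k s : ℝ) : HasDerivAt (chi k) (deriv (chi k) s) s ∧ deriv (chi k) s ≤ 0 := by
  refine ⟨((chi_cd k).differentiable (by norm_num) s).hasDerivAt, ?_⟩
  apply Antitone.deriv_nonpos
  intro x y hxy
  exact Real.smoothTransition.monotone (by linarith)

/-- weight times cutoff times g² -/
noncomputable def HH (a β σ : ℝ) (V : ℝ → ℝ) (k : ℝ) (g : Pt n m → ℝ) (p : Pt n m) : ℝ :=
  chi k (ss a β σ p) * g p ^ 2 * Real.exp (-V (ss a β σ p))

variable {a β σ : ℝ} {V V' V'' : ℝ → ℝ}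

theorem FF_zero (hσ : 0 < σ) (ha : 0 < a) (hβ : 0 < β) (L k : ℝ) (g : Pt n m → ℝ) (i : Fin n) {p : Pt n m}
    (hp : tt p = 0) : (fun p => HH a β σ V k g p * WW Λ a β σ L i p) =ᶠ[nhds p] fun _ => 0 := by
  obtain ⟨δ, hδ, h⟩ := small_t hσ (k + 1)
  have hc : Continuous (tt : Pt n m → ℝ) := (contDiff_tt).continuous
  have : ∀ᶠ q in nhds p, tt q < δ := hc.continuousAt.eventually_lt continuousAt_const (by rw [hp]; exact hδ)
  filter_upwards [this] with q hq
  rcases (tt_nonneg q).eq_or_lt with h0 | h0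
  · have hx : ∀ i, q.1 i = 0 := by
      intro i
      have := (Finset.sum_eq_zero_iff_of_nonneg (fun i _ => sq_nonneg (q.1 i))).1 h0.symm i (Finset.mem_univ i)
      simpa using this
    have hy : ∀ i, yy Λ i q = 0 := fun i => by simp [yy, hx]
    have hq' : ∀ i, qq Λ i q = 0 := fun i => by simp [qq, hy]
    simp [WW, hx, hy, hq']
  · have h1 := (h _ h0 hq).trans (ss_ge (σ := σ) ha hβ q)
    have : chi k (ss a β σ q) = 0 := Real.smoothTransition.zero_of_nonpos (by linarith)
    simp [HH, this]

theorem cd_HH (ha : 0 < a) (hβ : 0 < β) (hV' : ∀ s > (0 : ℝ), HasDerivAt V (V' s) s)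
    (hV'' : ∀ s > (0 : ℝ), HasDerivAt V' (V'' s) s) (k : ℝ) {g : Pt n m → ℝ} (hg : ContDiff ℝ 1 g)
    {p : Pt n m} (hp : 0 < tt p) : ContDiffAt ℝ 1 (HH a β σ V k g) p := by
  have hs := cd_ss (β := β) (σ := σ) ha hp
  have hV := (cd_V hV' hV'' (ss_pos (σ := σ) ha hβ hp)).comp p hs
  have h1 : ContDiffAt ℝ 1 (fun p => chi k (ss a β σ p)) p := (chi_cd k).contDiffAt.comp p hs
  have h2 : ContDiffAt ℝ 1 (fun p => Real.exp (-V (ss a β σ p))) p := Real.contDiff_exp.contDiffAt.comp p hV.neg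
  exact (h1.mul (hg.contDiffAt.pow 2)).mul h2

theorem cd_FF (hσ : 0 < σ) (ha : 0 < a) (hβ : 0 < β) (hV' : ∀ s > (0 : ℝ), HasDerivAt V (V' s) s)
    (hV'' : ∀ s > (0 : ℝ), HasDerivAt V' (V'' s) s) (L k : ℝ) {g : Pt n m → ℝ} (hg : ContDiff ℝ 1 g) (i : Fin n) :
    ContDiff ℝ 1 (fun p => HH a β σ V k g p * WW Λ a β σ L i p) := by
  rw [contDiff_iff_contDiffAt]
  intro p
  rcases (tt_nonneg p).eq_or_lt with h0 | h0
  · exact contDiffAt_const.congr_of_eventuallyEq (FF_zero hσ ha hβ L k g i h0.symm)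
  · exact (cd_HH ha hβ hV' hV'' k hg h0).mul (cd_WW ha h0 i)

theorem HH_zero (ha : 0 < a) (hβ : 0 < β) (k : ℝ) (g : Pt n m → ℝ) {p : Pt n m} (hp : (k + 1) / β + ((k + 1) / β) ^ 2 / √a < ‖p‖) :
    HH a β σ V k g p = 0 := by
  have : (k + 1) / β < Nrm a p := by
    by_contra h
    exact absurd (norm_le_of_Nrm ha (not_lt.1 h)) (not_le.2 hp)
  rw [div_lt_iff₀ hβ] at this
  have h0 : 0 ≤ xnorm p ^ (-σ) := Real.rpow_nonneg (Real.sqrt_nonneg _) _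
  have : chi k (ss a β σ p) = 0 := Real.smoothTransition.zero_of_nonpos (by unfold ss; linarith)
  simp [HH, this]

theorem cs_FF (ha : 0 < a) (hβ : 0 < β) (L k : ℝ) (g : Pt n m → ℝ) (i : Fin n) :
    HasCompactSupport (fun p => HH a β σ V k g p * WW Λ a β σ L i p) := by
  refine HasCompactSupport.intro (isCompact_closedBall (0 : Pt n m) ((k + 1) / β + ((k + 1) / β) ^ 2 / √a)) ?_
  intro p hp
  rw [mem_closedBall_zero_iff, not_le] at hp
  rw [HH_zero ha hβ k g hp, zero_mul]

theorem pointwise (hskew : ∀ k i l, Λ k i l = -Λ k l i) (hσ : 0 < σ) (ha : 0 < a) (hβ : 0 < β)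
    (hV' : ∀ s > (0 : ℝ), HasDerivAt V (V' s) s)
    (hV'' : ∀ s > (0 : ℝ), HasDerivAt V' (V'' s) s) {L : ℝ} (hL : 0 < L) (k : ℝ) {g : Pt n m → ℝ} (hg : ContDiff ℝ 1 g)
    {p : Pt n m} (hp : 0 < tt p) :
    ∑ i, X Λ i (fun p => HH a β σ V k g p * WW Λ a β σ L i p) p ≤
      chi k (ss a β σ p) * Real.exp (-V (ss a β σ p)) * (gradSq Λ g p - g p ^ 2 *
      (V' (ss a β σ p) * wsE σ β a L (tt p) (Nrm a p) (sY Λ p) (tt p ^ (-σ / 2 - 1))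
        - divE n σ β a L (tt p) (Nrm a p) (sY Λ p) (sU Λ p) (sG Λ p) (sF Λ p) (tt p ^ (-σ / 2 - 1))
        - ∑ i, WW Λ a β σ L i p ^ 2)) := by
  rw [← sum_dWW hskew ha hp, ← sum_WW_ss hskew p]
  have hws0 : 0 ≤ ∑ i, WW Λ a β σ L i p * ((β * tt p / Nrm a p ^ 3 - σ * tt p ^ (-σ / 2 - 1)) * p.1 i +
      β * a / (4 * Nrm a p ^ 3) * yy Λ i p) := by
    rw [sum_WW_ss hskew]
    have hN := Nrm_pos ha hp
    have hY := sY_nonneg (Λ := Λ) p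
    have := wsE_ge (σ := σ) (β := β) (a := a) (L := L) (t := tt p) (N := Nrm a p) (ζ := zz p) (Y := sY Λ p) (η := tt p ^ (-σ / 2 - 1)) hσ hβ ha hL hN (zz_nonneg p) (Nrm_pow4 ha p) hY (Real.rpow_pos_of_pos hp _)
    refine le_trans ?_ this
    positivity
  set ds : Fin n → ℝ := fun i => (β * tt p / Nrm a p ^ 3 - σ * tt p ^ (-σ / 2 - 1)) * p.1 i +
      β * a / (4 * Nrm a p ^ 3) * yy Λ i p with hds
  set s := ss a β σ p with hs
  have hs0 : 0 < s := ss_pos ha hβ hp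
  have hsX : ∀ i, HasX Λ i (ss a β σ) p (ds i) := fun i => HasX.hss ha hp i
  obtain ⟨hχ, hχ0⟩ := chi_deriv k s
  set E := Real.exp (-V s) with hE
  have hder : ∀ i, X Λ i (fun p => HH a β σ V k g p * WW Λ a β σ L i p) p =
      (deriv (chi k) s - chi k s * V' s) * g p ^ 2 * E * (WW Λ a β σ L i p * ds i)
      + chi k s * E * (2 * g p * (WW Λ a β σ L i p * X Λ i g p)) + chi k s * E * g p ^ 2 * dWW Λ a β σ L i p := by
    intro i
    have h1 : HasX Λ i (fun p => chi k (ss a β σ p)) p (deriv (chi k) s * ds i) := HasX.comp hχ (hsX i)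
    have h2 : HasX Λ i (fun p => g p ^ 2) p (2 * g p * X Λ i g p) :=
      HasX.comp (φ := fun r => r ^ 2) (φ' := 2 * g p) (by simpa using hasDerivAt_pow 2 (g p))
        (HasX.of_diff (hg.differentiable (by norm_num) p))
    have h3 : HasX Λ i (fun p => Real.exp (-V (ss a β σ p))) p (E * (-V' s) * ds i) :=
      HasX.comp (φ := fun s => Real.exp (-V s)) ((hV' s hs0).neg.exp) (hsX i)
    have h4 := ((h1.mul h2).mul h3).mul (HasX.hWW (Λ := Λ) (β := β) (σ := σ) (L := L) ha hp i)
    refine (HasX.eq h4 (((cd_HH ha hβ hV' hV'' k hg hp).mul (cd_WW ha hp i)).differentiableAt (by norm_num))).trans ?_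
    simp only [← hs, ← hE]
    ring
  simp only [hder]
  rw [Finset.sum_add_distrib, Finset.sum_add_distrib, ← Finset.mul_sum, ← Finset.mul_sum, ← Finset.mul_sum,
    ← Finset.mul_sum]
  set ws := ∑ i, WW Λ a β σ L i p * ds i with hws
  set dv := ∑ i, dWW Λ a β σ L i p
  set ww := ∑ i, WW Λ a β σ L i p ^ 2 with hww
  have hcs : 2 * g p * ∑ i, WW Λ a β σ L i p * X Λ i g p ≤ g p ^ 2 * ww + gradSq Λ g p := by
    rw [hww, gradSq, Finset.mul_sum, Finset.mul_sum, ← Finset.sum_add_distrib]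
    refine Finset.sum_le_sum fun i _ => ?_
    nlinarith [sq_nonneg (g p * WW Λ a β σ L i p - X Λ i g p)]
  have hE0 : 0 < E := Real.exp_pos _
  have hχp : 0 ≤ chi k s := Real.smoothTransition.nonneg _
  have f1 : deriv (chi k) s * (g p ^ 2 * E * ws) ≤ 0 := mul_nonpos_of_nonpos_of_nonneg hχ0 (by positivity)
  have f2 := mul_le_mul_of_nonneg_left hcs (mul_nonneg hχp hE0.le)
  linarith

end carnotUbound

section carnotUboundFinal
variable {n m : ℕ} {Λ : Fin m → Fin n → Fin n → ℝ}
variable {a β σ : ℝ} {V V' V'' : ℝ → ℝ}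

/-- the core region -/
def DD (n m : ℕ) (a β σ R : ℝ) : Set (Pt n m) := {p | 0 < tt p ∧ ss a β σ p ≤ R}

theorem measurable_tt : Measurable (tt : Pt n m → ℝ) := (contDiff_tt).continuous.measurable
theorem measurable_ss : Measurable (ss a β σ : Pt n m → ℝ) := by
  have h : (ss a β σ : Pt n m → ℝ) = fun p => β * (tt p ^ 2 + a * zz p) ^ ((1 : ℝ) / 4) + tt p ^ (-σ / 2) := by
    ext p; simp only [ss, xnorm_rpow, Nrm_eq]
  have h1 := measurable_tt (n := n) (m := m)
  have h2 : Measurable (zz : Pt n m → ℝ) := (contDiff_zz).continuous.measurable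
  rw [h]
  exact (measurable_const.mul (((h1.pow_const 2).add (measurable_const.mul h2)).pow_const _)).add (h1.pow_const _)

theorem measurableSet_DD {R : ℝ} : MeasurableSet (DD n m a β σ R) :=
  (measurableSet_lt measurable_const measurable_tt).inter (measurableSet_le measurable_ss measurable_const)

theorem gradSq_nonneg (g : Pt n m → ℝ) (p : Pt n m) : 0 ≤ gradSq Λ g p :=
  Finset.sum_nonneg fun _ _ => sq_nonneg _

theorem q_lower (hskew : ∀ k i l, Λ k i l = -Λ k l i) (hLI : LinearIndependent ℝ Λ)
    (hσ : 0 < σ) (hσn : σ < (n : ℝ) - 2) (ha : 0 < a) (hβ : 0 < β)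
    (hVmono : StrictMonoOn V (Set.Ioi (0 : ℝ)))
    (hV' : ∀ s > (0 : ℝ), HasDerivAt V (V' s) s)
    (hV'' : ∀ s > (0 : ℝ), HasDerivAt V' (V'' s) s)
    (hV2 : Tendsto (fun s => s ^ (-(2 * (1 + σ))) * ((1 / 4) * (V' s) ^ 2 - (1 / 2) * V'' s))
      atTop atTop) :
    ∃ L > 0, ∃ R : ℝ, ∃ b ≥ 0, ∀ p : Pt n m, 0 < tt p →
      1 - (DD n m a β σ R).indicator (fun _ => b) p ≤
      V' (ss a β σ p) * wsE σ β a L (tt p) (Nrm a p) (sY Λ p) (tt p ^ (-σ / 2 - 1))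
        - divE n σ β a L (tt p) (Nrm a p) (sY Λ p) (sU Λ p) (sG Λ p) (sF Λ p) (tt p ^ (-σ / 2 - 1))
        - ∑ i, WW Λ a β σ L i p ^ 2 := by
  obtain ⟨c0, hc0, hc⟩ := exists_c0 hLI
  obtain ⟨L, hL, M, hM, R0, hR0, CD, hCD, H⟩ := key_real (n := n) hσ hσn hβ ha (KL_nonneg (Λ := Λ)) hc0
  obtain ⟨hpos, hgr⟩ := V'_growth hσ hVmono hV' hV'' hV2
  obtain ⟨R1, hR1, hgr⟩ := hgr M hM
  obtain ⟨b, hb, hbb⟩ := ww_bdd (L := L) (R := max R0 R1) hσ hβ ha (KL_nonneg (Λ := Λ))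
  refine ⟨L, hL, max R0 R1, 1 + CD + b, by positivity, fun p hp => ?_⟩
  have hS := scal_pt ha hc hp
  obtain ⟨H1, H2⟩ := H _ _ _ _ _ _ _ hS
  have hse : β * Nrm a p + tt p ^ (-σ / 2) = ss a β σ p := by rw [ss, xnorm_rpow]
  by_cases hD : p ∈ DD n m a β σ (max R0 R1)
  · rw [Set.indicator_of_mem hD]
    have h1 := hbb _ _ _ _ (sQ Λ p) (∑ i, WW Λ a β σ L i p ^ 2) hp hS.hN hS.hζ hS.hP hS.hY hS.hYK (sQ_le p)
      (sum_WW_sq p) (by rw [hse]; exact hD.2)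
    have h2 := wsE_ge (σ := σ) (β := β) (a := a) (L := L) (t := tt p) (N := Nrm a p) (ζ := zz p) (Y := sY Λ p) (η := tt p ^ (-σ / 2 - 1)) hσ hβ ha hL hS.hN (zz_nonneg p) (Nrm_pow4 ha p) hS.hY (Real.rpow_pos_of_pos hp _)
    have h3 : 0 ≤ wsE σ β a L (tt p) (Nrm a p) (sY Λ p) (tt p ^ (-σ / 2 - 1)) := by
      refine le_trans ?_ h2
      have := hS.hN
      have := hS.hY
      positivity
    have h4 := mul_nonneg (hpos _ (ss_pos (σ := σ) ha hβ hp)) h3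
    linarith
  · rw [Set.indicator_of_notMem hD]
    have hD' : max R0 R1 < ss a β σ p := by
      by_contra h
      exact hD ⟨hp, not_lt.1 h⟩
    have h1 := H2 (sQ Λ p) (∑ i, WW Λ a β σ L i p ^ 2) (V' (ss a β σ p)) (sQ_le p) (sum_WW_sq p)
      (by rw [hse]; exact (le_max_left _ _).trans hD'.le)
      (by rw [hse]; exact hgr _ ((le_max_right _ _).trans hD'.le))
    linarith

theorem ubound (hn : 0 < n) (hskew : ∀ k i l, Λ k i l = -Λ k l i) (hLI : LinearIndependent ℝ Λ)
    (hσ : 0 < σ) (hσn : σ < (n : ℝ) - 2) (ha : 0 < a) (hβ : 0 < β)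
    (hVmono : StrictMonoOn V (Set.Ioi (0 : ℝ)))
    (hV' : ∀ s > (0 : ℝ), HasDerivAt V (V' s) s)
    (hV'' : ∀ s > (0 : ℝ), HasDerivAt V' (V'' s) s)
    (hV2 : Tendsto (fun s => s ^ (-(2 * (1 + σ))) * ((1 / 4) * (V' s) ^ 2 - (1 / 2) * V'' s))
      atTop atTop)
    (hZint : Integrable (fun p : Pt n m => Real.exp (-(Uadd a β σ V p)))) :
    ∃ R : ℝ, ∃ b ≥ (0 : ℝ), ∀ g : Pt n m → ℝ, ContDiff ℝ 1 g → (∃ C, ∀ p, |g p| ≤ C) →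
      Integrable (fun p => gradSq Λ g p * Real.exp (-(Uadd a β σ V p))) →
      ∫ p, g p ^ 2 * Real.exp (-(Uadd a β σ V p)) ≤
        (∫ p, gradSq Λ g p * Real.exp (-(Uadd a β σ V p))) +
        b * ∫ p in DD n m a β σ R, g p ^ 2 * Real.exp (-(Uadd a β σ V p)) := by
  obtain ⟨L, hL, R, b, hb, hq⟩ := q_lower (n := n) hskew hLI hσ hσn ha hβ hVmono hV' hV'' hV2
  refine ⟨R, b, hb, fun g hg ⟨C, hC⟩ hgi => ?_⟩
  set e : Pt n m → ℝ := fun p => Real.exp (-(Uadd a β σ V p)) with he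
  have hep : ∀ p, 0 < e p := fun p => Real.exp_pos _
  set q : Pt n m → ℝ := fun p => 1 - (DD n m a β σ R).indicator (fun _ => b) p with hqd
  have hqm : Measurable q := measurable_const.sub (measurable_const.indicator measurableSet_DD)
  have hqb : ∀ p, |q p| ≤ 1 + b := by
    intro p
    by_cases hD : p ∈ DD n m a β σ R
    · simp only [hqd, Set.indicator_of_mem hD]; rw [abs_le]; constructor <;> linarith
    · simp only [hqd, Set.indicator_of_notMem hD]; rw [abs_le]; constructor <;> linarith
  have hgb : ∀ p, g p ^ 2 ≤ C ^ 2 := fun p => sq_le_sq' (abs_le.1 (hC p)).1 (abs_le.1 (hC p)).2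
  have hχ0 : ∀ k s, 0 ≤ chi k s := fun k s => Real.smoothTransition.nonneg _
  have hχ1 : ∀ k s, chi k s ≤ 1 := fun k s => Real.smoothTransition.le_one _
  have hχm : ∀ k, Measurable (fun p : Pt n m => chi k (ss a β σ p)) := fun k =>
    (chi_cd k).continuous.measurable.comp measurable_ss
  have hbi : Integrable (fun p => (1 + b) * C ^ 2 * e p) := hZint.const_mul _
  have hgm : AEStronglyMeasurable (fun p => g p ^ 2 * e p) volume :=
    (hg.continuous.pow 2).aestronglyMeasurable.mul hZint.aestronglyMeasurable
  have hmeas : ∀ k, AEStronglyMeasurable (fun p => chi k (ss a β σ p) * (q p * (g p ^ 2 * e p))) volume :=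
    fun k => (hχm k).aestronglyMeasurable.mul (hqm.aestronglyMeasurable.mul hgm)
  have hbound : ∀ k p, ‖chi k (ss a β σ p) * (q p * (g p ^ 2 * e p))‖ ≤ (1 + b) * C ^ 2 * e p := by
    intro k p
    rw [norm_mul, norm_mul, norm_mul, Real.norm_of_nonneg (hχ0 _ _), Real.norm_of_nonneg (sq_nonneg _),
      Real.norm_of_nonneg (hep p).le, Real.norm_eq_abs]
    have h1 : |q p| * (g p ^ 2 * e p) ≤ (1 + b) * (C ^ 2 * e p) := by
      have := hgb p; have := hqb p; have := (hep p).le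
      gcongr
    calc _ ≤ 1 * (|q p| * (g p ^ 2 * e p)) := by
          have h2 : 0 ≤ |q p| * (g p ^ 2 * e p) := by have := (hep p).le; positivity
          exact mul_le_mul_of_nonneg_right (hχ1 _ _) h2
      _ ≤ _ := by linarith
  have hint : ∀ k, Integrable (fun p => chi k (ss a β σ p) * (q p * (g p ^ 2 * e p))) := fun k =>
    hbi.mono' (hmeas k) (ae_of_all _ (hbound k))
  have hgi' : ∀ k, Integrable (fun p => chi k (ss a β σ p) * (gradSq Λ g p * e p)) := fun k =>
    hgi.mono' ((hχm k).aestronglyMeasurable.mul hgi.aestronglyMeasurable) (ae_of_all _ fun p => by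
      have h1 : 0 ≤ gradSq Λ g p * e p := mul_nonneg (gradSq_nonneg g p) (hep p).le
      rw [norm_mul, Real.norm_of_nonneg (hχ0 _ _), Real.norm_of_nonneg h1]
      exact mul_le_of_le_one_left h1 (hχ1 _ _))
  have hk : ∀ k : ℝ, ∫ p, chi k (ss a β σ p) * (q p * (g p ^ 2 * e p)) ≤ ∫ p, gradSq Λ g p * e p := by
    intro k
    have hX : ∀ i, _ := fun i => integral_X (Λ := Λ) (cd_FF (Λ := Λ) (a := a) (β := β) (σ := σ) hσ ha hβ hV' hV'' L k hg i) (cs_FF ha hβ L k g i) i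
    have h0 : ∫ p, ∑ i, X Λ i (fun p => HH a β σ V k g p * WW Λ a β σ L i p) p = 0 := by
      rw [integral_finsetSum _ fun i _ => (hX i).1]
      exact Finset.sum_eq_zero fun i _ => (hX i).2
    have h1 : ∫ p, ∑ i, X Λ i (fun p => HH a β σ V k g p * WW Λ a β σ L i p) p ≤
        ∫ p, (chi k (ss a β σ p) * (gradSq Λ g p * e p) - chi k (ss a β σ p) * (q p * (g p ^ 2 * e p))) := by
      refine integral_mono_ae (integrable_finsetSum _ fun i _ => (hX i).1) ((hgi' k).sub (hint k)) ?_
      filter_upwards [null_tt hn] with p hp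
      refine (pointwise hskew hσ ha hβ hV' hV'' hL k hg hp).trans ?_
      have h2 := mul_le_mul_of_nonneg_left (hq p hp) (mul_nonneg (mul_nonneg (hχ0 k (ss a β σ p)) (hep p).le) (sq_nonneg (g p)))
      have h3 : Real.exp (-V (ss a β σ p)) = e p := rfl
      rw [h3]
      have h4 : q p = 1 - (DD n m a β σ R).indicator (fun _ => b) p := rfl
      rw [← h4] at h2
      linarith
    rw [h0, integral_sub (hgi' k) (hint k)] at h1
    refine (sub_nonneg.1 h1).trans ?_
    refine integral_mono (hgi' k) hgi fun p => ?_
    exact mul_le_of_le_one_left (mul_nonneg (gradSq_nonneg g p) (hep p).le) (hχ1 _ _)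
  have hlim : Tendsto (fun k : ℕ => ∫ p, chi k (ss a β σ p) * (q p * (g p ^ 2 * e p))) atTop
      (nhds (∫ p, q p * (g p ^ 2 * e p))) := by
    refine tendsto_integral_of_dominated_convergence _ (fun k => hmeas k) hbi (fun k => ae_of_all _ (hbound k))
      (ae_of_all _ fun p => ?_)
    refine tendsto_const_nhds.congr' ?_
    filter_upwards [eventually_ge_atTop ⌈ss a β σ p⌉₊] with k hkk
    have : ss a β σ p ≤ k := (Nat.le_ceil _).trans (by exact_mod_cast hkk)
    have : chi k (ss a β σ p) = 1 := Real.smoothTransition.one_of_one_le (by linarith)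
    rw [this, one_mul]
  have hfin : ∫ p, q p * (g p ^ 2 * e p) ≤ ∫ p, gradSq Λ g p * e p := le_of_tendsto' hlim fun k => hk k
  have hge : Integrable (fun p => g p ^ 2 * e p) :=
    (hZint.const_mul (C ^ 2)).mono' hgm (ae_of_all _ fun p => by
      rw [Real.norm_of_nonneg (mul_nonneg (sq_nonneg _) (hep p).le)]
      exact mul_le_mul_of_nonneg_right (hgb p) (hep p).le)
  have hsplit : (fun p => q p * (g p ^ 2 * e p)) = fun p => g p ^ 2 * e p -
      (DD n m a β σ R).indicator (fun p => b * (g p ^ 2 * e p)) p := by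
    ext p
    by_cases hD : p ∈ DD n m a β σ R
    · simp only [hqd, Set.indicator_of_mem hD]; ring
    · simp only [hqd, Set.indicator_of_notMem hD]; ring
  rw [hsplit, integral_sub hge ((hge.const_mul b).indicator measurableSet_DD),
    integral_indicator measurableSet_DD, integral_const_mul] at hfin
  linarith
end carnotUboundFinal

open scoped ENNReal

section carnotLocal
variable {n m : ℕ} (Λ : Fin m → Fin n → Fin n → ℝ)

noncomputable def Bf (y x : Fin n → ℝ) (k : Fin m) : ℝ := ∑ i, y i * uu Λ k i x

/-- group law -/
noncomputable def mulP (p h : Pt n m) : Pt n m := (p.1 + h.1, p.2 + h.2 + (1 / 2 : ℝ) • Bf Λ h.1 p.1)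

theorem Bf_add_left (y y' x : Fin n → ℝ) : Bf Λ (y + y') x = Bf Λ y x + Bf Λ y' x := by
  ext k; simp [Bf, add_mul, Finset.sum_add_distrib]
theorem uu_add (k : Fin m) (i : Fin n) (x x' : Fin n → ℝ) : uu Λ k i (x + x') = uu Λ k i x + uu Λ k i x' := by
  simp [uu, mul_add, Finset.sum_add_distrib]
theorem uu_smul (k : Fin m) (i : Fin n) (c : ℝ) (x : Fin n → ℝ) : uu Λ k i (c • x) = c * uu Λ k i x := by
  simp only [uu, Finset.mul_sum, Pi.smul_apply, smul_eq_mul]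
  exact Finset.sum_congr rfl fun l _ => by ring
theorem Bf_add_right (y x x' : Fin n → ℝ) : Bf Λ y (x + x') = Bf Λ y x + Bf Λ y x' := by
  ext k; simp [Bf, mul_add, Finset.sum_add_distrib, uu_add]
theorem Bf_smul_left (c : ℝ) (y x : Fin n → ℝ) : Bf Λ (c • y) x = c • Bf Λ y x := by
  ext k; simp only [Bf, Finset.mul_sum, Pi.smul_apply, smul_eq_mul]
  exact Finset.sum_congr rfl fun l _ => by ring
theorem Bf_smul_right (c : ℝ) (y x : Fin n → ℝ) : Bf Λ y (c • x) = c • Bf Λ y x := by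
  ext k; simp only [Bf, uu_smul, Finset.mul_sum, Pi.smul_apply, smul_eq_mul]
  exact Finset.sum_congr rfl fun l _ => by ring
theorem Bf_zero_left (x : Fin n → ℝ) : Bf Λ 0 x = 0 := by ext k; simp [Bf]
theorem Bf_zero_right (x : Fin n → ℝ) : Bf Λ x 0 = 0 := by ext k; simp [Bf, uu]
theorem Bf_self (hskew : ∀ k i l, Λ k i l = -Λ k l i) (x : Fin n → ℝ) : Bf Λ x x = 0 := by
  ext k
  simp only [Bf, uu, Finset.mul_sum, Pi.zero_apply]
  exact skew_quad (hskew k) x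
theorem Bf_single (i j : Fin n) : Bf Λ (Pi.single i 1) (Pi.single j 1) = fun k => Λ k i j := by
  ext k
  simp [Bf, uu, Pi.single_apply]

theorem continuous_Bf : Continuous (fun q : (Fin n → ℝ) × (Fin n → ℝ) => Bf Λ q.1 q.2) := by
  unfold Bf uu; fun_prop
theorem continuous_mulP : Continuous (fun q : Pt n m × Pt n m => mulP Λ q.1 q.2) := by
  unfold mulP
  have h : Continuous (fun q : Pt n m × Pt n m => Bf Λ q.2.1 q.1.1) :=
    (continuous_Bf Λ).comp (by fun_prop : Continuous fun q : Pt n m × Pt n m => (q.2.1, q.1.1))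
  fun_prop

theorem mulP_assoc (p h k : Pt n m) : mulP Λ (mulP Λ p h) k = mulP Λ p (mulP Λ h k) := by
  refine Prod.ext ?_ ?_
  · simp [mulP, add_assoc]
  · simp only [mulP, Bf_add_right, Bf_add_left, smul_add]
    abel

theorem mp_right (h : Pt n m) : MeasurePreserving (fun p => mulP Λ p h) (volume : Measure (Pt n m)) volume := by
  have hm : Measurable (Function.uncurry fun (x : Fin n → ℝ) (z : Fin m → ℝ) => z + h.2 + (1 / 2 : ℝ) • Bf Λ h.1 x) := by
    have h2 : Continuous fun x => Bf Λ h.1 x := (continuous_Bf Λ).comp (by fun_prop : Continuous fun x => (h.1, x))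
    apply Continuous.measurable
    unfold Function.uncurry
    fun_prop
  exact (measurePreserving_add_right volume h.1).skew_product hm (ae_of_all _ fun x => by
    have := (measurePreserving_add_right (volume : Measure (Fin m → ℝ)) (h.2 + (1 / 2 : ℝ) • Bf Λ h.1 x)).map_eq
    simpa [add_assoc] using this)

theorem mp_left (p : Pt n m) : MeasurePreserving (fun h => mulP Λ p h) (volume : Measure (Pt n m)) volume := by
  have hm : Measurable (Function.uncurry fun (y : Fin n → ℝ) (z : Fin m → ℝ) => p.2 + z + (1 / 2 : ℝ) • Bf Λ y p.1) := by
    have h2 : Continuous fun x => Bf Λ x p.1 := (continuous_Bf Λ).comp (by fun_prop : Continuous fun x => (x, p.1))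
    apply Continuous.measurable
    unfold Function.uncurry
    fun_prop
  exact (measurePreserving_add_left volume p.1).skew_product hm (ae_of_all _ fun x => by
    have := (measurePreserving_add_left (volume : Measure (Fin m → ℝ)) (p.2 + (1 / 2 : ℝ) • Bf Λ x p.1)).map_eq
    simpa [add_right_comm] using this)

/-- change of variables inequality -/
theorem lint_le {φ : Pt n m → Pt n m} (hφ : MeasurePreserving φ (volume : Measure (Pt n m)) volume)
    {K K' : Set (Pt n m)} (hK : MeasurableSet K) (hK' : MeasurableSet K') (hKK : ∀ p ∈ K, φ p ∈ K') {G : Pt n m → ℝ≥0∞}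
    (hG : Measurable G) : ∫⁻ p in K, G (φ p) ≤ ∫⁻ p in K', G p := by
  rw [← lintegral_indicator hK, ← lintegral_indicator hK', ← hφ.lintegral_comp (hG.indicator hK')]
  refine lintegral_mono fun p => ?_
  by_cases hp : p ∈ K
  · simp [hp, hKK p hp]
  · simp [hp]

theorem lint_le' {φ : Pt n m → Pt n m} (hφ : MeasurePreserving φ (volume : Measure (Pt n m)) volume)
    {K K' : Set (Pt n m)} (hK : MeasurableSet K) (hK' : MeasurableSet K') (hKK : ∀ p, φ p ∈ K → p ∈ K') {G : Pt n m → ℝ≥0∞}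
    (hG : Measurable G) : ∫⁻ p in K, G p ≤ ∫⁻ p in K', G (φ p) := by
  rw [← lintegral_indicator hK, ← lintegral_indicator hK', ← hφ.lintegral_comp (hG.indicator hK)]
  refine lintegral_mono fun p => ?_
  by_cases hp : φ p ∈ K
  · simp [hp, hKK p hp]
  · simp [hp]

/-- weighted energy -/
noncomputable def En (w : Pt n m → ℝ≥0∞) (f : Pt n m → ℝ) : ℝ≥0∞ := ∫⁻ p, ENNReal.ofReal (gradSq Λ f p) * w p

def LocW (w : Pt n m → ℝ≥0∞) : Prop :=
  ∀ K : Set (Pt n m), IsCompact K → (∀ p ∈ K, p.1 ≠ 0) → ∃ C : ℝ≥0∞, C ≠ ∞ ∧ ∀ p ∈ K, 1 ≤ C * w p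

def Good (w : Pt n m → ℝ≥0∞) (K H : Set (Pt n m)) : Prop :=
  ∃ c : ℝ≥0∞, c ≠ ∞ ∧ ∀ h ∈ H, ∀ f : Pt n m → ℝ, ContDiff ℝ 1 f →
    ∫⁻ p in K, ENNReal.ofReal ((f (mulP Λ p h) - f p) ^ 2) ≤ c * En Λ w f

variable {Λ}
variable {w : Pt n m → ℝ≥0∞}

theorem Good.mono {K K' H H' : Set (Pt n m)} (h : Good Λ w K H) (hK : K' ⊆ K) (hH : H' ⊆ H) : Good Λ w K' H' := by
  obtain ⟨c, hc, h⟩ := h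
  exact ⟨c, hc, fun g hg f hf => (lintegral_mono_set hK).trans (h g (hH hg) f hf)⟩

theorem ofReal_sq_add (a b : ℝ) : ENNReal.ofReal ((a + b) ^ 2) ≤ 2 * ENNReal.ofReal (a ^ 2) + 2 * ENNReal.ofReal (b ^ 2) := by
  have h2 : (2 : ℝ≥0∞) = ENNReal.ofReal 2 := by simp
  rw [h2, ← ENNReal.ofReal_mul (by norm_num), ← ENNReal.ofReal_mul (by norm_num),
    ← ENNReal.ofReal_add (by positivity) (by positivity)]
  apply ENNReal.ofReal_le_ofReal
  nlinarith [sq_nonneg (a - b)]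

theorem cont_sq {f : Pt n m → ℝ} (hf : Continuous f) (h : Pt n m) :
    Measurable fun p => ENNReal.ofReal ((f (mulP Λ p h) - f p) ^ 2) := by
  have h1 : Continuous fun p => mulP Λ p h := (continuous_mulP Λ).comp (by fun_prop : Continuous fun p => (p, h))
  have : Continuous fun p => (f (mulP Λ p h) - f p) ^ 2 := by fun_prop
  exact this.measurable.ennreal_ofReal

theorem Good.comp {K K' H H' : Set (Pt n m)} (hK : MeasurableSet K) (hK' : MeasurableSet K') (h : Good Λ w K H) (h' : Good Λ w K' H')
    (hKK : ∀ p ∈ K, ∀ g ∈ H, mulP Λ p g ∈ K') : Good Λ w K {q | ∃ g ∈ H, ∃ g' ∈ H', q = mulP Λ g g'} := by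
  obtain ⟨c, hc, h⟩ := h
  obtain ⟨c', hc', h'⟩ := h'
  refine ⟨2 * c' + 2 * c, by finiteness, ?_⟩
  rintro _ ⟨g, hg, g', hg', rfl⟩ f hf
  have hfc := hf.continuous
  calc ∫⁻ p in K, ENNReal.ofReal ((f (mulP Λ p (mulP Λ g g')) - f p) ^ 2)
      ≤ ∫⁻ p in K, (2 * ENNReal.ofReal ((f (mulP Λ (mulP Λ p g) g') - f (mulP Λ p g)) ^ 2)
          + 2 * ENNReal.ofReal ((f (mulP Λ p g) - f p) ^ 2)) := by
        refine lintegral_mono fun p => ?_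
        rw [← mulP_assoc]
        convert ofReal_sq_add _ _ using 3
        ring
    _ = 2 * (∫⁻ p in K, ENNReal.ofReal ((f (mulP Λ (mulP Λ p g) g') - f (mulP Λ p g)) ^ 2))
          + 2 * ∫⁻ p in K, ENNReal.ofReal ((f (mulP Λ p g) - f p) ^ 2) := by
        rw [lintegral_add_right _ ((cont_sq hfc g).const_mul 2), lintegral_const_mul' _ _ (by finiteness), lintegral_const_mul' _ _ (by finiteness)]
    _ ≤ 2 * (c' * En Λ w f) + 2 * (c * En Λ w f) := by
        gcongr
        · exact (lint_le (mp_right Λ g) hK hK' (fun p hp => hKK p hp g hg) (cont_sq hfc g')).trans (h' g' hg' f hf)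
        · exact h g hg f hf
    _ = _ := by ring

end carnotLocal

open scoped ENNReal

section carnotSeg
variable {n m : ℕ} {Λ : Fin m → Fin n → Fin n → ℝ} {w : Pt n m → ℝ≥0∞}

theorem hasDeriv_flow (hskew : ∀ k i l, Λ k i l = -Λ k l i) {f : Pt n m → ℝ} (hf : ContDiff ℝ 1 f) (p : Pt n m)
    (y : Fin n → ℝ) (t : ℝ) :
    HasDerivAt (fun t : ℝ => f (mulP Λ p (t • y, 0))) (∑ i, y i * X Λ i f (mulP Λ p (t • y, 0))) t := by
  have h1 : HasDerivAt (fun t : ℝ => mulP Λ p (t • y, 0)) (y, (1 / 2 : ℝ) • Bf Λ y p.1) t := by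
    have e : (fun t : ℝ => mulP Λ p (t • y, 0)) = fun t : ℝ => p + t • ((y, (1 / 2 : ℝ) • Bf Λ y p.1) : Pt n m) := by
      ext t j
      · simp [mulP]
      · simp [mulP, Bf_smul_left]; ring
    rw [e]
    simpa using ((hasDerivAt_id t).smul_const ((y, (1 / 2 : ℝ) • Bf Λ y p.1) : Pt n m)).const_add p
  have h2 := ((hf.differentiable (by norm_num)) (mulP Λ p (t • y, 0))).hasFDerivAt.comp_hasDerivAt t h1
  refine h2.congr_deriv ?_
  simp only [X_eq]
  simp only [← smul_eq_mul, ← map_smul, ← map_sum]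
  congr 1
  have hs : (1 / 2 : ℝ) • Bf Λ y p.1 = (1 / 2 : ℝ) • Bf Λ y (p.1 + t • y) := by
    rw [Bf_add_right, Bf_smul_right, Bf_self Λ hskew]; simp
  rw [hs]
  ext j
  · simp [vX, Prod.fst_sum, Pi.single_apply]
  · simp [vX, Prod.snd_sum, mulP, Bf, Finset.mul_sum]
    refine Finset.sum_congr rfl fun i _ => ?_
    ring

theorem sq_int_le {φ : ℝ → ℝ} (hφ : Continuous φ) : (∫ t in (0:ℝ)..1, φ t) ^ 2 ≤ ∫ t in (0:ℝ)..1, φ t ^ 2 := by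
  set c := ∫ t in (0:ℝ)..1, φ t with hc
  have h : 0 ≤ ∫ t in (0:ℝ)..1, (φ t - c) ^ 2 :=
    intervalIntegral.integral_nonneg (by norm_num) fun t _ => sq_nonneg _
  have e : ∫ t in (0:ℝ)..1, (φ t - c) ^ 2 = (∫ t in (0:ℝ)..1, φ t ^ 2) - c ^ 2 := by
    have : (fun t => (φ t - c) ^ 2) = fun t => φ t ^ 2 - 2 * c * φ t + c ^ 2 := by ext t; ring
    rw [this, intervalIntegral.integral_add, intervalIntegral.integral_sub, intervalIntegral.integral_const_mul, ← hc]
    · simp; ring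
    all_goals exact Continuous.intervalIntegrable (by fun_prop) _ _
  linarith

theorem gradSq_cont {f : Pt n m → ℝ} (hf : ContDiff ℝ 1 f) : Continuous (gradSq Λ f) := by
  unfold gradSq
  have := fun i => X_cont_int (Λ := Λ) hf i
  fun_prop

theorem seg_point (hskew : ∀ k i l, Λ k i l = -Λ k l i) {f : Pt n m → ℝ} (hf : ContDiff ℝ 1 f) (p : Pt n m)
    (y : Fin n → ℝ) : ENNReal.ofReal ((f (mulP Λ p (y, 0)) - f p) ^ 2) ≤
      ENNReal.ofReal (∑ i, y i ^ 2) * ∫⁻ t in Set.Ioc (0 : ℝ) 1, ENNReal.ofReal (gradSq Λ f (mulP Λ p (t • y, 0))) := by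
  have hc : Continuous fun t : ℝ => mulP Λ p (t • y, 0) :=
    (continuous_mulP Λ).comp (by fun_prop : Continuous fun t : ℝ => (p, ((t • y, 0) : Pt n m)))
  have hX := fun i => X_cont_int (Λ := Λ) hf i
  have hG := gradSq_cont (Λ := Λ) hf
  have h1 : ∫ t in (0:ℝ)..1, (∑ i, y i * X Λ i f (mulP Λ p (t • y, 0))) = f (mulP Λ p (y, 0)) - f p := by
    rw [intervalIntegral.integral_eq_sub_of_hasDerivAt (fun t _ => hasDeriv_flow hskew hf p y t)]
    · simp [mulP, Bf_zero_left]
    · exact Continuous.intervalIntegrable (by fun_prop) _ _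
  rw [← h1]
  have hGc : Continuous fun t : ℝ => gradSq Λ f (mulP Λ p (t • y, 0)) := by fun_prop
  have h2 : (∫ t in (0:ℝ)..1, (∑ i, y i * X Λ i f (mulP Λ p (t • y, 0)))) ^ 2 ≤
      (∑ i, y i ^ 2) * ∫ t in (0:ℝ)..1, gradSq Λ f (mulP Λ p (t • y, 0)) := by
    refine (sq_int_le (by fun_prop)).trans ?_
    rw [← intervalIntegral.integral_const_mul]
    refine intervalIntegral.integral_mono_on (by norm_num) (Continuous.intervalIntegrable (by fun_prop) _ _)
      (Continuous.intervalIntegrable (by fun_prop) _ _) fun t _ => ?_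
    exact sum_mul_sq_le _ _
  refine (ENNReal.ofReal_le_ofReal h2).trans ?_
  rw [ENNReal.ofReal_mul (Finset.sum_nonneg fun _ _ => sq_nonneg _), intervalIntegral.integral_of_le (by norm_num),
    ofReal_integral_eq_lintegral_ofReal]
  · exact (hGc.integrableOn_Icc (a := 0) (b := 1)).mono_set Set.Ioc_subset_Icc_self
  · exact ae_of_all _ fun t => gradSq_nonneg _ _

theorem seg (hskew : ∀ k i l, Λ k i l = -Λ k l i) (hw : LocW w) {K : Set (Pt n m)} {Y : Set (Fin n → ℝ)}
    (hK : IsCompact K) (hY : IsCompact Y)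
    (h0 : ∀ p ∈ K, ∀ y ∈ Y, ∀ t ∈ Set.Icc (0 : ℝ) 1, p.1 + t • y ≠ 0) :
    Good Λ w K {h | ∃ y ∈ Y, h = (y, 0)} := by
  set K' : Set (Pt n m) := (fun q : Pt n m × (Fin n → ℝ) × ℝ => mulP Λ q.1 (q.2.2 • q.2.1, 0)) '' (K ×ˢ (Y ×ˢ Set.Icc (0:ℝ) 1)) with hK'
  have hcont : Continuous (fun q : Pt n m × (Fin n → ℝ) × ℝ => mulP Λ q.1 (q.2.2 • q.2.1, 0)) :=
    (continuous_mulP Λ).comp (by fun_prop : Continuous fun q : Pt n m × (Fin n → ℝ) × ℝ => (q.1, ((q.2.2 • q.2.1, 0) : Pt n m)))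
  have hcK : IsCompact K' := (hK.prod (hY.prod isCompact_Icc)).image hcont
  obtain ⟨C, hC, hCw⟩ := hw K' hcK (by
    rintro _ ⟨⟨p, y, t⟩, ⟨hp, hy, ht⟩, rfl⟩
    exact h0 p hp y hy t ht)
  obtain ⟨b, hb⟩ := (hY.image (by fun_prop : Continuous fun y : Fin n → ℝ => ∑ i, y i ^ 2)).bddAbove
  refine ⟨ENNReal.ofReal b * C, by finiteness, ?_⟩
  rintro _ ⟨y, hy, rfl⟩ f hf
  have hG : Measurable fun p => ENNReal.ofReal (gradSq Λ f p) := (gradSq_cont hf).measurable.ennreal_ofReal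
  have hyb : ∑ i, y i ^ 2 ≤ b := hb ⟨y, hy, rfl⟩
  have hE : ∫⁻ p in K', ENNReal.ofReal (gradSq Λ f p) ≤ C * En Λ w f := by
    calc _ ≤ ∫⁻ p in K', C * (ENNReal.ofReal (gradSq Λ f p) * w p) := by
          refine setLIntegral_mono' hcK.measurableSet fun p hp => ?_
          calc _ = ENNReal.ofReal (gradSq Λ f p) * 1 := by rw [mul_one]
            _ ≤ ENNReal.ofReal (gradSq Λ f p) * (C * w p) := by gcongr; exact hCw p hp
            _ = _ := by ring
      _ ≤ ∫⁻ p, C * (ENNReal.ofReal (gradSq Λ f p) * w p) := setLIntegral_le_lintegral _ _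
      _ = _ := lintegral_const_mul' _ _ hC
  calc _ ≤ ∫⁻ p in K, ENNReal.ofReal b * ∫⁻ t in Set.Ioc (0 : ℝ) 1, ENNReal.ofReal (gradSq Λ f (mulP Λ p (t • y, 0))) := by
        refine lintegral_mono fun p => ?_
        refine (seg_point hskew hf p y).trans ?_
        gcongr
    _ = ENNReal.ofReal b * ∫⁻ p in K, ∫⁻ t in Set.Ioc (0 : ℝ) 1, ENNReal.ofReal (gradSq Λ f (mulP Λ p (t • y, 0))) :=
        lintegral_const_mul' _ _ (by finiteness)
    _ = ENNReal.ofReal b * ∫⁻ t in Set.Ioc (0 : ℝ) 1, ∫⁻ p in K, ENNReal.ofReal (gradSq Λ f (mulP Λ p (t • y, 0))) := by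
        rw [lintegral_lintegral_swap]
        apply Measurable.aemeasurable
        have h1 : Continuous fun q : Pt n m × ℝ => mulP Λ q.1 (q.2 • y, 0) :=
          (continuous_mulP Λ).comp (by fun_prop : Continuous fun q : Pt n m × ℝ => (q.1, ((q.2 • y, 0) : Pt n m)))
        exact hG.comp h1.measurable
    _ ≤ ENNReal.ofReal b * ∫⁻ t in Set.Ioc (0 : ℝ) 1, C * En Λ w f := by
        refine mul_le_mul' le_rfl ?_
        refine setLIntegral_mono' measurableSet_Ioc fun t ht => ?_
        refine le_trans ?_ hE
        exact lint_le (mp_right Λ (t • y, 0)) hK.measurableSet hcK.measurableSet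
          (fun p hp => ⟨(p, y, t), ⟨hp, hy, Set.Ioc_subset_Icc_self ht⟩, rfl⟩) hG
    _ = _ := by simp [mul_assoc]
end carnotSeg

open scoped ENNReal

section carnotBox
variable {n m : ℕ} {Λ : Fin m → Fin n → Fin n → ℝ} {w : Pt n m → ℝ≥0∞}

/-- half-space box -/
def Bx (m : ℕ) (ℓ : (Fin n → ℝ) →L[ℝ] ℝ) (r R : ℝ) : Set (Pt n m) := {p | r ≤ ℓ p.1 ∧ ‖p‖ ≤ R}

theorem isCompact_Bx (ℓ : (Fin n → ℝ) →L[ℝ] ℝ) (r R : ℝ) : IsCompact (Bx m ℓ r R) := by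
  have h1 : IsClosed {p : Pt n m | r ≤ ℓ p.1} := isClosed_le continuous_const (by fun_prop)
  have : Bx m ℓ r R = {p : Pt n m | r ≤ ℓ p.1} ∩ Metric.closedBall 0 R := by
    ext p; simp [Bx]
  rw [this]
  exact (isCompact_closedBall 0 R).inter_left h1

theorem mulP_bdd (Λ : Fin m → Fin n → Fin n → ℝ) (R ρ : ℝ) :
    ∃ R', ∀ p h : Pt n m, ‖p‖ ≤ R → ‖h‖ ≤ ρ → ‖mulP Λ p h‖ ≤ R' := by
  have hc : IsCompact ((Metric.closedBall (0 : Pt n m) R) ×ˢ (Metric.closedBall (0 : Pt n m) ρ)) :=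
    (isCompact_closedBall 0 R).prod (isCompact_closedBall 0 ρ)
  obtain ⟨C, hC⟩ := hc.exists_bound_of_continuousOn (continuous_mulP Λ).continuousOn
  exact ⟨C, fun p h hp hh => hC (p, h) ⟨by simpa using hp, by simpa using hh⟩⟩

/-- good moves from every box -/
def GG (Λ : Fin m → Fin n → Fin n → ℝ) (w : Pt n m → ℝ≥0∞) (ℓ : (Fin n → ℝ) →L[ℝ] ℝ) (H : Set (Pt n m)) (r : ℝ) : Prop :=
  ∀ R, Good Λ w (Bx m ℓ r R) H

theorem GG.mono {ℓ : (Fin n → ℝ) →L[ℝ] ℝ} {H H' : Set (Pt n m)} {r r' : ℝ} (h : GG Λ w ℓ H r) (hH : H' ⊆ H) (hr : r ≤ r') :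
    GG Λ w ℓ H' r' := fun R => (h R).mono (fun _ hp => ⟨hr.trans hp.1, hp.2⟩) hH

theorem GG_seg (hskew : ∀ k i l, Λ k i l = -Λ k l i) (hw : LocW w) {ℓ : (Fin n → ℝ) →L[ℝ] ℝ} {Y : Set (Fin n → ℝ)}
    (hY : IsCompact Y) {r c : ℝ} (hc : ∀ y ∈ Y, c ≤ ℓ y) (hr : 0 < r) (hrc : 0 < r + c) :
    GG Λ w ℓ {h | ∃ y ∈ Y, h = (y, 0)} r := by
  intro R
  refine seg hskew hw (isCompact_Bx ℓ r R) hY ?_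
  rintro p ⟨hp, -⟩ y hy t ⟨ht0, ht1⟩ h0
  have h := congrArg ℓ h0
  simp only [map_add, map_smul, map_zero, smul_eq_mul] at h
  nlinarith [hc y hy, mul_nonneg ht0 (sub_nonneg.2 (hc y hy)), mul_nonneg (sub_nonneg.2 ht1) hr.le, mul_nonneg ht0 hrc.le]

theorem GG.comp {ℓ : (Fin n → ℝ) →L[ℝ] ℝ} {H H' : Set (Pt n m)} {r c ρ : ℝ} (h : GG Λ w ℓ H r) (h' : GG Λ w ℓ H' (r + c))
    (hc : ∀ h ∈ H, c ≤ ℓ h.1) (hb : ∀ h ∈ H, ‖h‖ ≤ ρ) : GG Λ w ℓ {q | ∃ g ∈ H, ∃ g' ∈ H', q = mulP Λ g g'} r := by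
  intro R
  obtain ⟨R', hR'⟩ := mulP_bdd Λ R ρ
  refine (h R).comp (isCompact_Bx ℓ r R).measurableSet (isCompact_Bx ℓ (r + c) R').measurableSet (h' R') ?_
  rintro p ⟨hp, hpR⟩ g hg
  refine ⟨?_, hR' p g hpR (hb g hg)⟩
  simp only [mulP, map_add]
  linarith [hc g hg]

theorem mulP_vert (w₁ w₂ : Fin m → ℝ) : mulP Λ ((0, w₁) : Pt n m) (0, w₂) = (0, w₁ + w₂) := by
  simp [mulP, Bf_zero_left]

theorem mulP_hv (y : Fin n → ℝ) (v : Fin m → ℝ) : mulP Λ ((y, 0) : Pt n m) (0, v) = (y, v) := by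
  simp [mulP, Bf_zero_left]

theorem mulP_loop (hskew : ∀ k i l, Λ k i l = -Λ k l i) (y y' : Fin n → ℝ) (hyy : Bf Λ y y' = - Bf Λ y' y) :
    mulP Λ (y, 0) (mulP Λ (y', 0) (mulP Λ (-y, 0) (-y', 0))) = ((0, Bf Λ y' y) : Pt n m) := by
  have e1 : ∀ a b : Fin n → ℝ, Bf Λ (-a) b = - Bf Λ a b := fun a b => by
    have := Bf_smul_left Λ (-1) a b; simpa using this
  have e2 : ∀ a b : Fin n → ℝ, Bf Λ a (-b) = - Bf Λ a b := fun a b => by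
    have := Bf_smul_right Λ (-1) a b; simpa using this
  refine Prod.ext ?_ ?_
  · simp only [mulP]; abel
  · simp only [mulP, Bf_add_left, e1, e2, Bf_self Λ hskew, hyy]
    ext k; simp; ring

/-- vertical direction admissible -/
def PV (Λ : Fin m → Fin n → Fin n → ℝ) (w : Pt n m → ℝ≥0∞) (ℓ : (Fin n → ℝ) →L[ℝ] ℝ) (v : Fin m → ℝ) : Prop :=
  ∀ M : ℝ, GG Λ w ℓ {h | ∃ t : ℝ, |t| ≤ M ∧ h = (0, t • v)} 1

theorem vert_bdd (M : ℝ) (v : Fin m → ℝ) : ∀ h ∈ {h : Pt n m | ∃ t : ℝ, |t| ≤ M ∧ h = (0, t • v)}, ‖h‖ ≤ M * ‖v‖ := by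
  rintro _ ⟨t, ht, rfl⟩
  simp only [Prod.norm_mk, norm_zero, norm_smul, Real.norm_eq_abs]
  have := mul_le_mul_of_nonneg_right ht (norm_nonneg v)
  exact max_le ((by positivity : (0:ℝ) ≤ |t| * ‖v‖).trans this) this

theorem PV_zero (ℓ : (Fin n → ℝ) →L[ℝ] ℝ) : PV Λ w ℓ 0 := by
  intro M R
  refine ⟨0, by simp, ?_⟩
  rintro _ ⟨t, -, rfl⟩ f hf
  have : ∀ p : Pt n m, mulP Λ p (0, t • 0) = p := fun p => by simp [mulP, Bf_zero_left]
  simp only [this]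
  simp

theorem PV_add {ℓ : (Fin n → ℝ) →L[ℝ] ℝ} {v v' : Fin m → ℝ} (h : PV Λ w ℓ v) (h' : PV Λ w ℓ v') : PV Λ w ℓ (v + v') := by
  intro M
  have h2 := (h M).comp (c := 0) (by simpa using h' M) (by rintro _ ⟨t, -, rfl⟩; simp) (vert_bdd M v)
  refine h2.mono ?_ le_rfl
  rintro _ ⟨t, ht, rfl⟩
  exact ⟨_, ⟨t, ht, rfl⟩, _, ⟨t, ht, rfl⟩, by rw [mulP_vert, smul_add]⟩

theorem PV_smul {ℓ : (Fin n → ℝ) →L[ℝ] ℝ} {v : Fin m → ℝ} (c : ℝ) (h : PV Λ w ℓ v) : PV Λ w ℓ (c • v) := by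
  intro M
  refine (h (M * |c|)).mono ?_ le_rfl
  rintro _ ⟨t, ht, rfl⟩
  exact ⟨t * c, by rw [abs_mul]; gcongr, by rw [smul_smul]⟩

theorem PV_loop (hskew : ∀ k i l, Λ k i l = -Λ k l i) (hw : LocW w) (ℓ : (Fin n → ℝ) →L[ℝ] ℝ) (y y' : Fin n → ℝ)
    (hy : 0 ≤ ℓ y) (hy' : ℓ y' = 0) (hyy : Bf Λ y y' = - Bf Λ y' y) : PV Λ w ℓ (Bf Λ y' y) := by
  intro M
  set Y' : Set (Fin n → ℝ) := (fun t : ℝ => t • y') '' Set.Icc (-M) M with hY'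
  have hYc : IsCompact Y' := isCompact_Icc.image (by fun_prop)
  have hYl : ∀ z ∈ Y', (0 : ℝ) ≤ ℓ z := by
    rintro _ ⟨t, -, rfl⟩; simp [hy']
  have hYl0 : ∀ h ∈ {h : Pt n m | ∃ y ∈ Y', h = (y, 0)}, (0 : ℝ) ≤ ℓ h.1 := by
    rintro _ ⟨z, hz, rfl⟩; exact hYl z hz
  obtain ⟨ρ, hρ⟩ := hYc.isBounded.exists_norm_le
  have s4 : GG Λ w ℓ {h | ∃ y ∈ Y', h = (y, 0)} 1 := GG_seg hskew hw hYc hYl one_pos (by norm_num)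
  have s3 : GG Λ w ℓ {h | ∃ z ∈ ({-y} : Set (Fin n → ℝ)), h = (z, 0)} (1 + ℓ y) :=
    GG_seg hskew hw isCompact_singleton (c := -ℓ y) (by simp) (by linarith) (by linarith)
  have s2 : GG Λ w ℓ {h | ∃ y ∈ Y', h = (y, 0)} (1 + ℓ y) := GG_seg hskew hw hYc hYl (by linarith) (by linarith)
  have s1 : GG Λ w ℓ {h | ∃ z ∈ ({y} : Set (Fin n → ℝ)), h = (z, 0)} 1 :=
    GG_seg hskew hw isCompact_singleton (c := ℓ y) (by simp) (by linarith) (by linarith)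
  have t3 := s3.comp (c := -ℓ y) (ρ := ‖y‖) (by rw [add_neg_cancel_right]; exact s4) (by simp) (by simp)
  have t2 := s2.comp (c := 0) (ρ := ρ) (by rw [add_zero]; exact t3) hYl0 (by
    rintro _ ⟨z, hz, rfl⟩; simpa using hρ z hz)
  have t1 := s1.comp (c := ℓ y) (ρ := ‖y‖) t2 (by simp) (by simp)
  refine t1.mono ?_ le_rfl
  rintro _ ⟨t, ht, rfl⟩
  obtain ⟨ht1, ht2⟩ := abs_le.1 ht
  refine ⟨(y, 0), ⟨y, rfl, rfl⟩, _, ⟨(t • y', 0), ⟨_, ⟨t, ⟨ht1, ht2⟩, rfl⟩, rfl⟩, _, ⟨(-y, 0), ⟨-y, rfl, rfl⟩, (-(t • y'), 0),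
    ⟨_, ⟨-t, ⟨by linarith, by linarith⟩, rfl⟩, by simp⟩, rfl⟩, rfl⟩, ?_⟩
  rw [mulP_loop hskew, Bf_smul_left]
  rw [Bf_smul_left, Bf_smul_right, hyy, smul_neg]

theorem PV_all (hskew : ∀ k i l, Λ k i l = -Λ k l i) (hLI : LinearIndependent ℝ Λ) (hw : LocW w) (i0 : Fin n) (s : ℝ) (hs : s ≠ 0)
    (v : Fin m → ℝ) :
    PV Λ w (s • ContinuousLinearMap.proj (R := ℝ) (φ := fun _ : Fin n => ℝ) i0) v := by
  set ℓ : (Fin n → ℝ) →L[ℝ] ℝ := s • ContinuousLinearMap.proj (R := ℝ) (φ := fun _ : Fin n => ℝ) i0 with hℓ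
  let S : Submodule ℝ (Fin m → ℝ) :=
    { carrier := {v | PV Λ w ℓ v}
      add_mem' := fun h h' => PV_add h h'
      zero_mem' := PV_zero ℓ
      smul_mem' := fun c _ h => PV_smul c h }
  have hskB : ∀ i j : Fin n, Bf Λ (Pi.single i 1) (Pi.single j 1) = - Bf Λ (Pi.single j 1) (Pi.single i 1) := by
    intro i j; rw [Bf_single, Bf_single]; ext k; simp [hskew k i j]
  have hmem1 : ∀ i j : Fin n, j ≠ i0 → (fun k => Λ k j i) ∈ S := by
    intro i j hj
    rw [← Bf_single]
    have hlj : ℓ (Pi.single j 1) = 0 := by simp [hℓ, hj.symm]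
    by_cases hi : 0 ≤ ℓ (Pi.single i 1)
    · exact PV_loop hskew hw ℓ _ _ hi hlj (hskB i j)
    · have h1 := PV_loop hskew hw ℓ (-Pi.single i 1) (Pi.single j 1) (by rw [map_neg]; linarith) hlj (by
        have e1 := Bf_smul_left Λ (-1) (Pi.single i 1) (Pi.single j 1)
        have e2 := Bf_smul_right Λ (-1) (Pi.single j 1) (Pi.single i 1)
        simp only [neg_one_smul] at e1 e2
        rw [e1, e2, hskB])
      have e2 := Bf_smul_right Λ (-1) (Pi.single j 1) (Pi.single i 1)
      simp only [neg_one_smul] at e2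
      rw [e2] at h1
      have h2 := PV_smul (-1) h1
      rw [neg_one_smul, neg_neg] at h2
      exact h2
  have hmem : ∀ i j : Fin n, (fun k => Λ k j i) ∈ S := by
    intro i j
    by_cases hj : j = i0
    · by_cases hi : i = i0
      · have : (fun k => Λ k j i) = 0 := by
          ext k; have := hskew k j i; subst hi; subst hj; simp; linarith
        rw [this]; exact S.zero_mem
      · have : (fun k => Λ k j i) = -(fun k => Λ k i j) := by ext k; simp [hskew k j i]
        rw [this]; exact S.neg_mem (hmem1 j i hi)
    · exact hmem1 i j hj
  have htop : S = ⊤ := by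
    by_contra hne
    obtain ⟨g, hg0, hg⟩ := Submodule.exists_le_ker_of_lt_top S (lt_top_iff_ne_top.2 hne)
    apply hg0
    have hz : ∀ k, g (Pi.single k 1) = 0 := by
      refine Fintype.linearIndependent_iff.1 hLI (fun k => g (Pi.single k 1)) ?_
      ext j i
      have := hg (hmem i j)
      rw [LinearMap.mem_ker, LinearMap.pi_apply_eq_sum_univ] at this
      simp only [Finset.sum_apply, Pi.smul_apply, smul_eq_mul, Pi.zero_apply]
      rw [← this]
      refine Finset.sum_congr rfl fun k _ => ?_
      rw [smul_eq_mul, mul_comm]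
      congr 2
      ext l; simp [Pi.single_apply, eq_comm]
    refine LinearMap.pi_ext' fun k => LinearMap.ext_ring ?_
    simpa using hz k
  have : v ∈ S := by rw [htop]; trivial
  exact this

/-- all bounded vertical moves -/
theorem GG_vert (hskew : ∀ k i l, Λ k i l = -Λ k l i) (hLI : LinearIndependent ℝ Λ) (hw : LocW w) (i0 : Fin n) (s : ℝ) (hs : s ≠ 0)
    (ρ : ℝ) : GG Λ w (s • ContinuousLinearMap.proj (R := ℝ) (φ := fun _ : Fin n => ℝ) i0) {h | h.1 = 0 ∧ ‖h.2‖ ≤ ρ} 1 := by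
  set ℓ : (Fin n → ℝ) →L[ℝ] ℝ := s • ContinuousLinearMap.proj (R := ℝ) (φ := fun _ : Fin n => ℝ) i0 with hℓ
  have key : ∀ T : Finset (Fin m), GG Λ w ℓ {h | h.1 = 0 ∧ ‖h.2‖ ≤ ρ ∧ ∀ k, k ∉ T → h.2 k = 0} 1 := by
    intro T
    induction T using Finset.induction_on with
    | empty =>
      refine (PV_zero (Λ := Λ) (w := w) ℓ 0).mono ?_ le_rfl
      rintro ⟨h1, h2⟩ ⟨h, -, h'⟩
      refine ⟨0, by simp, Prod.ext h ?_⟩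
      ext k; simpa using h' k (by simp)
    | insert k T hk ih =>
      have h1 := ih.comp (c := 0) (ρ := ρ) (by simpa using PV_all hskew hLI hw i0 s hs (Pi.single k 1) ρ) (by
        rintro h ⟨h1, -⟩; simp [h1]) (by
        rintro h ⟨h1, h2, -⟩
        rw [Prod.norm_def, h1, norm_zero]
        exact max_le ((norm_nonneg _).trans h2) h2)
      refine h1.mono ?_ le_rfl
      rintro ⟨x, z⟩ ⟨hx, hz, hT⟩
      dsimp only at hx hz hT
      subst hx
      have hρ := (norm_nonneg _).trans hz
      refine ⟨(0, Function.update z k 0), ⟨rfl, ?_, ?_⟩, (0, z k • Pi.single k 1), ⟨z k, (norm_le_pi_norm z k).trans hz, rfl⟩, ?_⟩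
      · refine (pi_norm_le_iff_of_nonneg hρ).2 fun j => ?_
        by_cases hj : j = k
        · subst hj; simpa using hρ
        · simpa [hj] using (norm_le_pi_norm z j).trans hz
      · intro j hj
        by_cases hjk : j = k
        · subst hjk; simp
        · simp [hjk]; exact hT j (by simp [hjk, hj])
      · rw [mulP_vert]
        congr 1
        ext j
        by_cases hj : j = k
        · subst hj; simp
        · simp [hj]
  exact (key Finset.univ).mono (fun h hh => ⟨hh.1, hh.2, by simp⟩) le_rfl

end carnotBox

open scoped ENNReal

section carnotLocP
variable {n m : ℕ} {Λ : Fin m → Fin n → Fin n → ℝ} {w : Pt n m → ℝ≥0∞}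

/-- abstract averaging: good moves connect any two points of `C` -/
theorem avg_point {C Hb : Set (Pt n m)} (hC : IsCompact C) (hHb : IsCompact Hb) (hC0 : volume C ≠ 0) (hg : Good Λ w C Hb)
    (hin : ∀ p ∈ C, ∀ h, mulP Λ p h ∈ C → h ∈ Hb) :
    ∃ c : ℝ≥0∞, c ≠ ∞ ∧ ∀ f : Pt n m → ℝ, ContDiff ℝ 1 f → ∃ m0 : ℝ,
      ∫⁻ q in C, ENNReal.ofReal ((f q - m0) ^ 2) ≤ c * En Λ w f := by
  obtain ⟨c, hc, hg⟩ := hg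
  have hCt : volume C ≠ ∞ := hC.measure_lt_top.ne
  have hHt : volume Hb ≠ ∞ := hHb.measure_lt_top.ne
  refine ⟨(c * volume Hb) / volume C, ENNReal.div_ne_top (by finiteness) hC0, ?_⟩
  intro f hf
  have hfc := hf.continuous
  have hcm := continuous_mulP Λ
  have key : ∫⁻ p in C, ∫⁻ q in C, ENNReal.ofReal ((f q - f p) ^ 2) ≤ c * volume Hb * En Λ w f := by
    calc ∫⁻ p in C, ∫⁻ q in C, ENNReal.ofReal ((f q - f p) ^ 2)
        ≤ ∫⁻ p in C, ∫⁻ h in Hb, ENNReal.ofReal ((f (mulP Λ p h) - f p) ^ 2) := by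
          refine setLIntegral_mono' hC.measurableSet fun p hp => ?_
          refine lint_le' (mp_left Λ p) hC.measurableSet hHb.measurableSet (hin p hp) (G := fun q => ENNReal.ofReal ((f q - f p) ^ 2)) ?_
          have : Continuous fun q => (f q - f p) ^ 2 := by fun_prop
          exact this.measurable.ennreal_ofReal
      _ = ∫⁻ h in Hb, ∫⁻ p in C, ENNReal.ofReal ((f (mulP Λ p h) - f p) ^ 2) := by
          refine lintegral_lintegral_swap ?_
          have : Continuous fun q : Pt n m × Pt n m => (f (mulP Λ q.1 q.2) - f q.1) ^ 2 := by fun_prop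
          exact this.measurable.ennreal_ofReal.aemeasurable
      _ ≤ ∫⁻ h in Hb, c * En Λ w f := setLIntegral_mono' hHb.measurableSet fun h hh => hg h hh f hf
      _ = c * volume Hb * En Λ w f := by rw [setLIntegral_const]; ring
  have hmeas : Measurable fun p => ∫⁻ q in C, ENNReal.ofReal ((f q - f p) ^ 2) := by
    have h1 : Continuous fun q : Pt n m × Pt n m => (f q.2 - f q.1) ^ 2 := by fun_prop
    exact h1.measurable.ennreal_ofReal.lintegral_prod_right'
  obtain ⟨p0, -, hp0⟩ := exists_le_setLAverage (μ := (volume : Measure (Pt n m))) (s := C)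
    (f := fun p => ∫⁻ q in C, ENNReal.ofReal ((f q - f p) ^ 2)) hC0 hCt hmeas.aemeasurable
  refine ⟨f p0, hp0.trans ?_⟩
  rw [setLAverage_eq]
  calc _ ≤ (c * volume Hb * En Λ w f) / volume C := by gcongr
    _ = _ := by simp only [div_eq_mul_inv]; ring

/-- pull back along one translation -/
theorem pull {C D : Set (Pt n m)} {h : Pt n m} (hC : MeasurableSet C) (hD : MeasurableSet D) (hg : Good Λ w D {h})
    (hDC : ∀ p ∈ D, mulP Λ p h ∈ C) {c : ℝ≥0∞} (hc : c ≠ ∞) :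
    ∃ c' : ℝ≥0∞, c' ≠ ∞ ∧ ∀ f : Pt n m → ℝ, ContDiff ℝ 1 f → ∀ m0 : ℝ,
      ∫⁻ q in C, ENNReal.ofReal ((f q - m0) ^ 2) ≤ c * En Λ w f →
      ∫⁻ q in D, ENNReal.ofReal ((f q - m0) ^ 2) ≤ c' * En Λ w f := by
  obtain ⟨c1, hc1, hg⟩ := hg
  refine ⟨2 * c1 + 2 * c, by finiteness, fun f hf m0 hm => ?_⟩
  have hfc := hf.continuous
  have hG : Measurable fun q => ENNReal.ofReal ((f q - m0) ^ 2) := by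
    have : Continuous fun q => (f q - m0) ^ 2 := by fun_prop
    exact this.measurable.ennreal_ofReal
  calc ∫⁻ q in D, ENNReal.ofReal ((f q - m0) ^ 2)
      ≤ ∫⁻ q in D, (2 * ENNReal.ofReal ((f (mulP Λ q h) - f q) ^ 2) + 2 * ENNReal.ofReal ((f (mulP Λ q h) - m0) ^ 2)) := by
        refine lintegral_mono fun q => ?_
        have := ofReal_sq_add (-(f (mulP Λ q h) - f q)) (f (mulP Λ q h) - m0)
        rw [neg_sq] at this
        convert this using 3
        ring
    _ = 2 * (∫⁻ q in D, ENNReal.ofReal ((f (mulP Λ q h) - f q) ^ 2)) + 2 * ∫⁻ q in D, ENNReal.ofReal ((f (mulP Λ q h) - m0) ^ 2) := by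
        rw [lintegral_add_left ((cont_sq hfc h).const_mul 2), lintegral_const_mul' _ _ (by finiteness), lintegral_const_mul' _ _ (by finiteness)]
    _ ≤ 2 * (c1 * En Λ w f) + 2 * (c * En Λ w f) := by
        gcongr
        · exact hg h rfl f hf
        · exact (lint_le (mp_right Λ h) hD hC hDC hG).trans hm
    _ = _ := by ring

/-- the reference cell -/
def Cell (m : ℕ) (i0 : Fin n) (S R3 R4 : ℝ) : Set (Pt n m) :=
  Metric.closedBall (S • Pi.single i0 1) R3 ×ˢ Metric.closedBall 0 R4

theorem mem_Cell {i0 : Fin n} {S R3 R4 : ℝ} {p : Pt n m} :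
    p ∈ Cell m i0 S R3 R4 ↔ ‖p.1 - S • Pi.single i0 1‖ ≤ R3 ∧ ‖p.2‖ ≤ R4 := by
  simp [Cell, Set.mem_prod, dist_eq_norm]

theorem isCompact_Cell (i0 : Fin n) (S R3 R4 : ℝ) : IsCompact (Cell m i0 S R3 R4) :=
  (isCompact_closedBall _ _).prod (isCompact_closedBall _ _)

theorem Cell_pos (i0 : Fin n) (S R3 R4 : ℝ) (h3 : 0 < R3) (h4 : 0 < R4) : volume (Cell m i0 S R3 R4) ≠ 0 := by
  have ho : IsOpen ((Metric.ball (S • Pi.single i0 1) R3 ×ˢ Metric.ball 0 R4) : Set (Pt n m)) := Metric.isOpen_ball.prod Metric.isOpen_ball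
  have hne : ((Metric.ball (S • Pi.single i0 1) R3 ×ˢ Metric.ball 0 R4) : Set (Pt n m)).Nonempty :=
    ⟨(S • Pi.single i0 1, 0), by simp [h3, h4]⟩
  have := ho.measure_pos volume hne
  exact (this.trans_le (measure_mono (Set.prod_mono Metric.ball_subset_closedBall Metric.ball_subset_closedBall))).ne'

theorem Cell_avg (hskew : ∀ k i l, Λ k i l = -Λ k l i) (hLI : LinearIndependent ℝ Λ) (hw : LocW w) (i0 : Fin n)
    {R3 R4 : ℝ} (h3 : 0 < R3) (h4 : 0 < R4) :
    ∃ c : ℝ≥0∞, c ≠ ∞ ∧ ∀ f : Pt n m → ℝ, ContDiff ℝ 1 f → ∃ m0 : ℝ,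
      ∫⁻ q in Cell m i0 (3 * R3 + 1) R3 R4, ENNReal.ofReal ((f q - m0) ^ 2) ≤ c * En Λ w f := by
  set S := 3 * R3 + 1 with hS
  have hBc : IsCompact ((Metric.closedBall (0 : Fin n → ℝ) (2 * R3)) ×ˢ (Metric.closedBall (S • Pi.single i0 1 : Fin n → ℝ) R3)) :=
    (isCompact_closedBall _ _).prod (isCompact_closedBall _ _)
  obtain ⟨CB, hCB⟩ := hBc.exists_bound_of_continuousOn (continuous_Bf Λ).continuousOn
  set ρ := 2 * R4 + (1 / 2) * CB with hρ
  set Hb : Set (Pt n m) := Metric.closedBall 0 (2 * R3) ×ˢ Metric.closedBall 0 ρ with hHb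
  have hHbc : IsCompact Hb := (isCompact_closedBall _ _).prod (isCompact_closedBall _ _)
  refine avg_point (isCompact_Cell i0 S R3 R4) hHbc (Cell_pos i0 S R3 R4 h3 h4) ?_ ?_
  · set ℓ : (Fin n → ℝ) →L[ℝ] ℝ := (1 : ℝ) • ContinuousLinearMap.proj (R := ℝ) (φ := fun _ : Fin n => ℝ) i0 with hℓ
    have hℓa : ∀ y, ℓ y = y i0 := fun y => by simp [hℓ]
    have hYl : ∀ y ∈ Metric.closedBall (0 : Fin n → ℝ) (2 * R3), -(2 * R3) ≤ ℓ y := by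
      intro y hy
      rw [mem_closedBall_zero_iff] at hy
      rw [hℓa]
      exact (abs_le.1 ((norm_le_pi_norm y i0).trans hy)).1
    have s1 := GG_seg (Λ := Λ) (w := w) (ℓ := ℓ) hskew hw (isCompact_closedBall (0 : Fin n → ℝ) (2 * R3)) (r := 2 * R3 + 1) (c := -(2 * R3))
      hYl (by linarith) (by linarith)
    have s2 := s1.comp (c := -(2 * R3)) (ρ := 2 * R3) (H' := {h | h.1 = 0 ∧ ‖h.2‖ ≤ ρ})
      (by rw [show 2 * R3 + 1 + -(2 * R3) = 1 by ring]; exact GG_vert hskew hLI hw i0 1 one_ne_zero ρ)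
      (by rintro _ ⟨y, hy, rfl⟩; exact hYl y hy)
      (by rintro _ ⟨y, hy, rfl⟩; simpa [Prod.norm_mk] using hy)
    obtain ⟨Rb, hRb⟩ := (isCompact_Cell (m := m) i0 S R3 R4).isBounded.exists_norm_le
    refine (s2 Rb).mono ?_ ?_
    · intro p hp
      refine ⟨?_, hRb p hp⟩
      obtain ⟨hp1, -⟩ := mem_Cell.1 hp
      have := (abs_le.1 ((norm_le_pi_norm _ i0).trans hp1)).1
      rw [hℓa]
      simp at this
      linarith
    · rintro ⟨y, v⟩ ⟨hy, hv⟩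
      exact ⟨(y, 0), ⟨y, hy, rfl⟩, (0, v), ⟨rfl, by simpa using hv⟩, (mulP_hv y v).symm⟩
  · intro p hp h hph
    obtain ⟨hp1, hp2⟩ := mem_Cell.1 hp
    obtain ⟨hq1, hq2⟩ := mem_Cell.1 hph
    simp only [mulP] at hq1 hq2
    have a1 : ‖h.1‖ ≤ 2 * R3 := by
      have : h.1 = (p.1 + h.1 - S • Pi.single i0 1) - (p.1 - S • Pi.single i0 1) := by abel
      rw [this]
      exact (norm_sub_le _ _).trans (by linarith)
    have a2 := hCB (h.1, p.1) ⟨by simpa using a1, by simpa [dist_eq_norm] using hp1⟩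
    have a3 : ‖h.2‖ ≤ ρ := by
      have : h.2 = (p.2 + h.2 + (1 / 2 : ℝ) • Bf Λ h.1 p.1) - p.2 - (1 / 2 : ℝ) • Bf Λ h.1 p.1 := by abel
      rw [this]
      refine (norm_sub_le _ _).trans ?_
      have b1 := norm_sub_le (p.2 + h.2 + (1 / 2 : ℝ) • Bf Λ h.1 p.1) p.2
      have b2 : ‖(1 / 2 : ℝ) • Bf Λ h.1 p.1‖ ≤ (1 / 2) * CB := by
        rw [norm_smul]; norm_num at a2 ⊢; linarith
      linarith
    exact ⟨by simpa using a1, by simpa using a3⟩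

/-- the annular region, one half -/
def Dh (m : ℕ) (i1 : Fin n) (s r0 R : ℝ) : Set (Pt n m) := {p | r0 ≤ tt p ∧ ‖p‖ ≤ R ∧ 0 ≤ s * p.1 i1}

theorem isCompact_Dh (i1 : Fin n) (s r0 R : ℝ) : IsCompact (Dh m i1 s r0 R) := by
  have h1 : IsClosed {p : Pt n m | r0 ≤ tt p} := isClosed_le continuous_const (by unfold tt; fun_prop)
  have h2 : IsClosed {p : Pt n m | 0 ≤ s * p.1 i1} := isClosed_le continuous_const (by fun_prop)
  have : Dh m i1 s r0 R = ({p : Pt n m | r0 ≤ tt p} ∩ {p : Pt n m | 0 ≤ s * p.1 i1}) ∩ Metric.closedBall 0 R := by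
    ext p; simp [Dh]; tauto
  rw [this]
  exact (isCompact_closedBall 0 R).inter_left (h1.inter h2)

theorem move (hskew : ∀ k i l, Λ k i l = -Λ k l i) (hw : LocW w) {i0 i1 : Fin n} (hi : i0 ≠ i1) {s : ℝ} (hs : s ^ 2 = 1)
    {r0 R S : ℝ} (hr0 : 0 < r0) :
    ∃ h : Pt n m, Good Λ w (Dh m i1 s r0 R) {h} ∧ ∃ R4, ∀ p ∈ Dh m i1 s r0 R, mulP Λ p h ∈ Cell m i0 S (R + 1) R4 := by
  set ℓ : (Fin n → ℝ) →L[ℝ] ℝ := s • ContinuousLinearMap.proj (R := ℝ) (φ := fun _ : Fin n => ℝ) i1 with hℓ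
  have hℓa : ∀ y, ℓ y = s * y i1 := fun y => by simp [hℓ]
  have hsa : |s| = 1 := by
    have := sq_abs s; rw [hs] at this
    nlinarith [abs_nonneg s]
  have s1 : Good Λ w (Dh m i1 s r0 R) {h | ∃ y ∈ ({s • Pi.single i1 1} : Set (Fin n → ℝ)), h = (y, 0)} := by
    refine seg hskew hw (isCompact_Dh i1 s r0 R) isCompact_singleton ?_
    rintro p ⟨hp, -, hp2⟩ y hy t ⟨ht0, -⟩ h0
    rw [Set.mem_singleton_iff] at hy
    subst hy
    have h1 := congrFun h0 i1
    simp at h1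
    have ht : t = 0 := by
      have : s * p.1 i1 + t = 0 := by linear_combination s * h1 - t * hs
      linarith
    subst ht
    have : p.1 = 0 := by simpa using h0
    have : tt p = 0 := by simp [tt, this]
    linarith
  have s2 : GG Λ w ℓ {h | ∃ y ∈ ({S • Pi.single i0 1} : Set (Fin n → ℝ)), h = (y, 0)} 1 := by
    refine GG_seg hskew hw isCompact_singleton (c := 0) ?_ one_pos (by norm_num)
    rintro y hy
    rw [Set.mem_singleton_iff] at hy
    subst hy
    rw [hℓa]
    simp [hi.symm]
  obtain ⟨R2, hR2⟩ := mulP_bdd Λ R 1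
  have hn1 : ‖(s • Pi.single i1 1 : Fin n → ℝ)‖ ≤ 1 := by
    rw [norm_smul, Real.norm_eq_abs, hsa, one_mul, Pi.norm_single]; simp
  have s3 := s1.comp (isCompact_Dh i1 s r0 R).measurableSet (isCompact_Bx ℓ 1 R2).measurableSet (s2 R2) (by
    rintro p ⟨-, hp1, hp2⟩ _ ⟨y, hy, rfl⟩
    rw [Set.mem_singleton_iff] at hy
    subst hy
    refine ⟨?_, hR2 _ _ hp1 (by simpa [Prod.norm_mk] using hn1)⟩
    rw [hℓa]
    simp [mulP]
    nlinarith)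
  set h : Pt n m := mulP Λ (s • Pi.single i1 1, 0) (S • Pi.single i0 1, 0) with hh
  obtain ⟨R4, hR4⟩ := mulP_bdd Λ R ‖h‖
  refine ⟨h, s3.mono le_rfl ?_, R4, ?_⟩
  · rintro _ rfl
    exact ⟨_, ⟨_, rfl, rfl⟩, _, ⟨_, rfl, rfl⟩, rfl⟩
  · rintro p ⟨-, hp1, -⟩
    refine mem_Cell.2 ⟨?_, (norm_snd_le _).trans (hR4 p h hp1 le_rfl)⟩
    have : (mulP Λ p h).1 - S • Pi.single i0 1 = p.1 + s • Pi.single i1 1 := by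
      simp only [mulP, hh]; abel
    rw [this]
    exact (norm_add_le _ _).trans (add_le_add ((norm_fst_le p).trans hp1) hn1)

theorem Cell_mono (i0 : Fin n) (S R3 : ℝ) {R4 R4' : ℝ} (h : R4 ≤ R4') : Cell m i0 S R3 R4 ⊆ Cell m i0 S R3 R4' :=
  fun _ hp => mem_Cell.2 ⟨(mem_Cell.1 hp).1, (mem_Cell.1 hp).2.trans h⟩

theorem local_poincare (hskew : ∀ k i l, Λ k i l = -Λ k l i) (hLI : LinearIndependent ℝ Λ) (hw : LocW w) {i0 i1 : Fin n} (hi : i0 ≠ i1)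
    {r0 R : ℝ} (hr0 : 0 < r0) (hR : 0 ≤ R) :
    ∃ c : ℝ≥0∞, c ≠ ∞ ∧ ∀ f : Pt n m → ℝ, ContDiff ℝ 1 f → ∃ m0 : ℝ,
      ∫⁻ q in {p | r0 ≤ tt p ∧ ‖p‖ ≤ R}, ENNReal.ofReal ((f q - m0) ^ 2) ≤ c * En Λ w f := by
  set S := 3 * (R + 1) + 1 with hS
  obtain ⟨hp, gp, Rp, hRp⟩ := move (Λ := Λ) (w := w) (S := S) hskew hw hi (s := 1) (by norm_num) (r0 := r0) (R := R) hr0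
  obtain ⟨hm, gm, Rm, hRm⟩ := move (Λ := Λ) (w := w) (S := S) hskew hw hi (s := -1) (by norm_num) (r0 := r0) (R := R) hr0
  set R4 := max 1 (max Rp Rm) with hR4
  have e1 : Rp ≤ R4 := (le_max_left _ _).trans (le_max_right _ _)
  have e2 : Rm ≤ R4 := (le_max_right _ _).trans (le_max_right _ _)
  obtain ⟨c, hc, H⟩ := Cell_avg (Λ := Λ) (w := w) hskew hLI hw i0 (R3 := R + 1) (R4 := R4) (by linarith)
    (lt_of_lt_of_le one_pos (le_max_left _ _))
  have hCm := (isCompact_Cell (m := m) i0 S (R + 1) R4).measurableSet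
  obtain ⟨c1, hc1, H1⟩ := pull hCm (isCompact_Dh i1 1 r0 R).measurableSet gp (fun p h => Cell_mono i0 S (R + 1) e1 (hRp p h)) hc
  obtain ⟨c2, hc2, H2⟩ := pull hCm (isCompact_Dh i1 (-1) r0 R).measurableSet gm (fun p h => Cell_mono i0 S (R + 1) e2 (hRm p h)) hc
  refine ⟨c1 + c2, by finiteness, fun f hf => ?_⟩
  obtain ⟨m0, hm0⟩ := H f hf
  refine ⟨m0, ?_⟩
  have hsub : {p : Pt n m | r0 ≤ tt p ∧ ‖p‖ ≤ R} ⊆ Dh m i1 1 r0 R ∪ Dh m i1 (-1) r0 R := by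
    rintro p ⟨h1, h2⟩
    rcases le_total 0 (p.1 i1) with h | h
    · exact Or.inl ⟨h1, h2, by linarith⟩
    · exact Or.inr ⟨h1, h2, by linarith⟩
  refine (lintegral_mono_set hsub).trans ((lintegral_union_le _ _ _).trans ?_)
  rw [add_mul]
  exact add_le_add (H1 f hf m0 hm0) (H2 f hf m0 hm0)

end carnotLocP

open scoped ENNReal

section carnotFinal
variable {n m : ℕ} {Λ : Fin m → Fin n → Fin n → ℝ} {a β σ : ℝ} {V : ℝ → ℝ}

theorem tt_pos_of_ne {p : Pt n m} (hp : p.1 ≠ 0) : 0 < tt p := by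
  refine lt_of_le_of_ne (tt_nonneg p) fun h => hp ?_
  have h2 := (Finset.sum_eq_zero_iff_of_nonneg (fun i _ => sq_nonneg (p.1 i))).1 h.symm
  ext i
  simpa using h2 i (Finset.mem_univ i)

theorem locW_exp (ha : 0 < a) (hβ : 0 < β) (hVmono : StrictMonoOn V (Set.Ioi (0 : ℝ))) :
    LocW (fun p : Pt n m => ENNReal.ofReal (Real.exp (-(Uadd a β σ V p)))) := by
  intro K hK hK0
  have hc : ContinuousOn (ss a β σ : Pt n m → ℝ) K := fun p hp =>
    (cd_ss (β := β) (σ := σ) ha (tt_pos_of_ne (hK0 p hp))).continuousAt.continuousWithinAt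
  obtain ⟨S, hS⟩ := hK.exists_bound_of_continuousOn hc
  refine ⟨ENNReal.ofReal (Real.exp (V S)), ENNReal.ofReal_ne_top, fun p hp => ?_⟩
  have h0 := ss_pos (σ := σ) ha hβ (tt_pos_of_ne (hK0 p hp))
  have h1 : ss a β σ p ≤ S := (le_abs_self _).trans (hS p hp)
  have h2 : V (ss a β σ p) ≤ V S := hVmono.monotoneOn h0 (h0.trans_le h1) h1
  rw [← ENNReal.ofReal_mul (Real.exp_pos _).le, ← Real.exp_add, ENNReal.one_le_ofReal]
  apply Real.one_le_exp
  have : Uadd a β σ V p = V (ss a β σ p) := rfl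
  linarith

theorem DD_sub (ha : 0 < a) (hβ : 0 < β) (hσ : 0 < σ) (R : ℝ) :
    ∃ r0 > 0, ∃ R1 ≥ 0, DD n m a β σ R ⊆ {p | r0 ≤ tt p ∧ ‖p‖ ≤ R1} := by
  obtain ⟨δ, hδ, h⟩ := small_t hσ (R + 1)
  refine ⟨δ, hδ, max 0 (R / β + (R / β) ^ 2 / √a), le_max_left _ _, ?_⟩
  rintro p ⟨hp, hR⟩
  refine ⟨?_, (norm_le_of_Nrm ha ?_).trans (le_max_right _ _)⟩
  · by_contra hlt
    have := h _ hp (not_le.1 hlt)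
    linarith [ss_ge (σ := σ) ha hβ p]
  · rw [le_div_iff₀ hβ]
    have : (0:ℝ) ≤ xnorm p ^ (-σ) := Real.rpow_nonneg (Real.sqrt_nonneg _) _
    unfold ss at hR
    linarith

theorem gradSq_sub_const (f : Pt n m → ℝ) (c : ℝ) (p : Pt n m) : gradSq Λ (fun q => f q - c) p = gradSq Λ f p := by
  simp only [gradSq, X, fderiv_sub_const]

theorem gradSq_bdd {f : Pt n m → ℝ} (hf : ContDiff ℝ 1 f) (hc : HasCompactSupport f) : ∃ C, ∀ p, ‖gradSq Λ f p‖ ≤ C := by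
  have h : HasCompactSupport (gradSq Λ f) := by
    refine (hc.fderiv (𝕜 := ℝ)).mono' ?_
    refine (fun p hp => ?_)
    by_contra hp'
    apply hp
    have : fderiv ℝ f p = 0 := image_eq_zero_of_notMem_tsupport hp'
    simp [gradSq, X, this]
  exact h.exists_bound_of_continuous (gradSq_cont hf)

theorem main_bound (hn : 2 < n)
    (hskew : ∀ k i l, Λ k i l = -Λ k l i) (hLI : LinearIndependent ℝ Λ)
    (hσ : 0 < σ) (hσn : σ < (n : ℝ) - 2) (hβ : 0 < β) (V' V'' : ℝ → ℝ)
    (hVnonneg : ∀ s > (0 : ℝ), 0 ≤ V s)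
    (hVmono : StrictMonoOn V (Set.Ioi (0 : ℝ)))
    (hV' : ∀ s > (0 : ℝ), HasDerivAt V (V' s) s)
    (hV'' : ∀ s > (0 : ℝ), HasDerivAt V' (V'' s) s)
    (hV2 : Tendsto (fun s => s ^ (-(2 * (1 + σ))) * ((1 / 4) * (V' s) ^ 2 - (1 / 2) * V'' s))
      atTop atTop) (ha : 0 < a)
    (hZint : Integrable (fun p : Pt n m => Real.exp (-(Uadd a β σ V p)))) :
    ∃ c > (0 : ℝ), ∀ f : Pt n m → ℝ, ContDiff ℝ 1 f → HasCompactSupport f → ∃ m0 : ℝ,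
      ∫ p, (f p - m0) ^ 2 * Real.exp (-(Uadd a β σ V p)) ≤ c * ∫ p, gradSq Λ f p * Real.exp (-(Uadd a β σ V p)) := by
  obtain ⟨R, b, hb, hub⟩ := ubound (by omega) hskew hLI hσ hσn ha hβ hVmono hV' hV'' hV2 hZint
  obtain ⟨r0, hr0, R1, hR1, hsub⟩ := DD_sub (n := n) (m := m) ha hβ hσ R
  obtain ⟨c, hc, hloc⟩ := local_poincare (Λ := Λ) hskew hLI (locW_exp (σ := σ) ha hβ hVmono)
    (i0 := ⟨0, by omega⟩) (i1 := ⟨1, by omega⟩) (by simp) hr0 hR1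
  refine ⟨1 + b * c.toReal, by positivity, fun f hf hfc => ?_⟩
  obtain ⟨m0, hm0⟩ := hloc f hf
  refine ⟨m0, ?_⟩
  obtain ⟨C, hC⟩ := hfc.exists_bound_of_continuous hf.continuous
  obtain ⟨C2, hC2⟩ := gradSq_bdd (Λ := Λ) hf hfc
  have hgc : Continuous (gradSq Λ f) := gradSq_cont hf
  have hgi : Integrable (fun p => gradSq Λ f p * Real.exp (-(Uadd a β σ V p))) :=
    hZint.bdd_mul hgc.aestronglyMeasurable (ae_of_all _ hC2)
  have h1 := hub (fun p => f p - m0) (hf.sub contDiff_const) ⟨C + |m0|, fun p => (abs_sub _ _).trans (by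
    have := hC p; rw [Real.norm_eq_abs] at this; linarith)⟩ (by simpa only [gradSq_sub_const] using hgi)
  simp only [gradSq_sub_const] at h1
  set I := ∫ p, gradSq Λ f p * Real.exp (-(Uadd a β σ V p)) with hI
  have hI0 : 0 ≤ I := integral_nonneg fun p => mul_nonneg (gradSq_nonneg _ _) (Real.exp_pos _).le
  have hEn : En Λ (fun p : Pt n m => ENNReal.ofReal (Real.exp (-(Uadd a β σ V p)))) f = ENNReal.ofReal I := by
    rw [hI, ofReal_integral_eq_lintegral_ofReal hgi (ae_of_all _ fun p => mul_nonneg (gradSq_nonneg _ _) (Real.exp_pos _).le)]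
    unfold En
    exact lintegral_congr fun p => (ENNReal.ofReal_mul (gradSq_nonneg _ _)).symm
  rw [hEn] at hm0
  have h2 : ∫ p in DD n m a β σ R, (f p - m0) ^ 2 * Real.exp (-(Uadd a β σ V p)) ≤ c.toReal * I := by
    have hms : AEStronglyMeasurable (fun p => (f p - m0) ^ 2 * Real.exp (-(Uadd a β σ V p))) (volume.restrict (DD n m a β σ R)) := by
      have hfc' := hf.continuous
      have : Continuous fun p => (f p - m0) ^ 2 := by fun_prop
      exact this.aestronglyMeasurable.mul hZint.aestronglyMeasurable.restrict
    rw [integral_eq_lintegral_of_nonneg_ae (ae_of_all _ fun p => by positivity) hms]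
    have h3 : ∫⁻ p in DD n m a β σ R, ENNReal.ofReal ((f p - m0) ^ 2 * Real.exp (-(Uadd a β σ V p))) ≤ c * ENNReal.ofReal I := by
      calc _ ≤ ∫⁻ p in DD n m a β σ R, ENNReal.ofReal ((f p - m0) ^ 2) := by
            refine setLIntegral_mono' measurableSet_DD fun p hp => ENNReal.ofReal_le_ofReal ?_
            have h4 : Real.exp (-(Uadd a β σ V p)) ≤ 1 := by
              rw [Real.exp_le_one_iff, neg_nonpos]
              exact hVnonneg _ (ss_pos ha hβ hp.1)
            nlinarith [sq_nonneg (f p - m0)]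
        _ ≤ _ := (lintegral_mono_set hsub).trans hm0
    have h5 := ENNReal.toReal_mono (by finiteness) h3
    rwa [ENNReal.toReal_mul, ENNReal.toReal_ofReal hI0] at h5
  nlinarith [mul_le_mul_of_nonneg_left h2 hb]

theorem gibbs_int {U : Pt n m → ℝ} (hZint : Integrable fun p => Real.exp (-(U p))) (F : Pt n m → ℝ) :
    ∫ p, F p ∂(gibbsP U) = (∫ p, Real.exp (-(U p)))⁻¹ * ∫ p, F p * Real.exp (-(U p)) := by
  have h0 : 0 ≤ ∫ p, Real.exp (-(U p)) := integral_nonneg fun p => (Real.exp_pos _).le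
  unfold gibbsP
  rw [integral_smul_measure, integral_withDensity_eq_integral_toReal_smul₀ hZint.aemeasurable.ennreal_ofReal
    (ae_of_all _ fun p => ENNReal.ofReal_lt_top), ENNReal.toReal_inv, ENNReal.toReal_ofReal h0, smul_eq_mul]
  congr 1
  refine integral_congr_ae (ae_of_all _ fun p => ?_)
  simp only [smul_eq_mul]
  rw [ENNReal.toReal_ofReal (Real.exp_pos _).le, mul_comm]

theorem var_le {U : Pt n m → ℝ} (hZint : Integrable fun p => Real.exp (-(U p))) (hZpos : 0 < ∫ p, Real.exp (-(U p)))
    {f : Pt n m → ℝ} (hf : Continuous f) {C : ℝ} (hC : ∀ p, ‖f p‖ ≤ C) (m0 : ℝ) :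
    ∫ p, (f p - (∫ p, Real.exp (-(U p)))⁻¹ * ∫ p, f p * Real.exp (-(U p))) ^ 2 * Real.exp (-(U p)) ≤
      ∫ p, (f p - m0) ^ 2 * Real.exp (-(U p)) := by
  set Z := ∫ p, Real.exp (-(U p)) with hZ
  set J := ∫ p, f p * Real.exp (-(U p)) with hJ
  have i1 : Integrable fun p => f p * Real.exp (-(U p)) := hZint.bdd_mul hf.aestronglyMeasurable (ae_of_all _ hC)
  have i2 : Integrable fun p => f p ^ 2 * Real.exp (-(U p)) :=
    hZint.bdd_mul (c := C ^ 2) (by fun_prop) (ae_of_all _ fun p => by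
      rw [norm_pow]; exact pow_le_pow_left₀ (norm_nonneg _) (hC p) 2)
  have key : ∀ c : ℝ, ∫ p, (f p - c) ^ 2 * Real.exp (-(U p)) = (∫ p, f p ^ 2 * Real.exp (-(U p))) - 2 * c * J + c ^ 2 * Z := by
    intro c
    have : (fun p => (f p - c) ^ 2 * Real.exp (-(U p))) =
        fun p => f p ^ 2 * Real.exp (-(U p)) - 2 * c * (f p * Real.exp (-(U p))) + c ^ 2 * Real.exp (-(U p)) := by
      ext p; ring
    have i3 : Integrable fun p => f p ^ 2 * Real.exp (-(U p)) - 2 * c * (f p * Real.exp (-(U p))) := i2.sub (i1.const_mul _)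
    rw [this, integral_add i3 (hZint.const_mul _), integral_sub i2 (i1.const_mul _),
      integral_const_mul, integral_const_mul]
  rw [key, key]
  have e : ((∫ p, f p ^ 2 * Real.exp (-(U p))) - 2 * m0 * J + m0 ^ 2 * Z) -
    ((∫ p, f p ^ 2 * Real.exp (-(U p))) - 2 * (Z⁻¹ * J) * J + (Z⁻¹ * J) ^ 2 * Z) = Z * (m0 - Z⁻¹ * J) ^ 2 := by
    field_simp
    ring
  have : 0 ≤ Z * (m0 - Z⁻¹ * J) ^ 2 := by positivity
  linarith

end carnotFinal

theorem type2_additive_taming_poincare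
    (n m : ℕ) (hn : 2 < n) (Λ : Fin m → Fin n → Fin n → ℝ)
    (hskew : ∀ k i l, Λ k i l = -Λ k l i) (hLI : LinearIndependent ℝ Λ)
    (σ β : ℝ) (hσ : σ ∈ Set.Ioo (0 : ℝ) ((n : ℝ) - 2)) (hβ : 0 < β)
    (V V' V'' : ℝ → ℝ)
    (hVnonneg : ∀ s > (0 : ℝ), 0 ≤ V s)
    (hVmono : StrictMonoOn V (Set.Ioi (0 : ℝ)))
    (hV' : ∀ s > (0 : ℝ), HasDerivAt V (V' s) s)
    (hV'' : ∀ s > (0 : ℝ), HasDerivAt V' (V'' s) s)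
    (hB : ∃ B > (0 : ℝ), ∃ R : ℝ, ∀ s ≥ R, B * V s ≤ s * V' s)
    (hV2 : Tendsto (fun s => s ^ (-(2 * (1 + σ))) * ((1 / 4) * (V' s) ^ 2 - (1 / 2) * V'' s))
      atTop atTop)
    (a : ℝ) (ha : 0 < a)
    (hZint : Integrable (fun p : Pt n m => Real.exp (-(Uadd a β σ V p))))
    (hZpos : 0 < ∫ p : Pt n m, Real.exp (-(Uadd a β σ V p))) :
    ∃ c > (0 : ℝ), ∀ f : Pt n m → ℝ, ContDiff ℝ (⊤ : ℕ∞) f → HasCompactSupport f →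
      ∫ p, (f p - ∫ q, f q ∂(gibbsP (Uadd a β σ V))) ^ 2 ∂(gibbsP (Uadd a β σ V))
        ≤ c * ∫ p, gradSq Λ f p ∂(gibbsP (Uadd a β σ V)) := by
  obtain ⟨c, hc, h⟩ := main_bound (Λ := Λ) hn hskew hLI hσ.1 hσ.2 hβ V' V'' hVnonneg hVmono hV' hV'' hV2 ha hZint
  refine ⟨c, hc, fun f hf hfc => ?_⟩
  have hf1 : ContDiff ℝ 1 f := hf.of_le (by exact_mod_cast le_top)
  obtain ⟨m0, hm0⟩ := h f hf1 hfc
  obtain ⟨C, hC⟩ := hfc.exists_bound_of_continuous hf.continuous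
  have hv := (var_le hZint hZpos hf.continuous hC m0).trans hm0
  rw [gibbs_int hZint, gibbs_int hZint, gibbs_int hZint]
  rw [mul_left_comm]
  exact mul_le_mul_of_nonneg_left hv (inv_nonneg.2 hZpos.le)
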